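/- (Decoupling across fiber-length scales.) Assume BH(s,r) holds for some 3/2 < s < 2 and r < s'. Let Ω ⊆ [0,1]² be measurable, and for K ∈ ℤ_{≥0} set Ω(K) = {ξ ∈ Ω : 2^{-K-1} ≤ 𝓗¹({η : (ξ₁,η) ∈ Ω}) ≤ 2^{-K+1}}. For each dyadic ε let 𝓚(ε) be the set of K ≥ 0 for which ε is the smallest dyadic number such that ∥𝓔χ_{Ω'}∥_{L^{2s}} ≤ ε|Ω(K)|^{1/s'} holds for all measurable Ω' ⊆ Ω(K), and for dyadic 0 < δ ≤ ε let Ω_δ(K) be the pieces furnished by the near-tile decomposition of Ω(K). Then ∥Σ_{K ∈ 𝓚(ε)} 𝓔χ_{Ω_δ(K)}∥_{L^{2s}}^{2s} ≲ (log δ^{-1})² Σ_{K ∈ 𝓚(ε)} ∥𝓔χ_{Ω_δ(K)}∥_{L^{2s}}^{2s} + δ |Ω|^{2s/s'}. -/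

import Mathlib

open MeasureTheory Set
open scoped ENNReal

/-- The extension operator for the hyperbolic paraboloid `τ = ξ₁ξ₂` in `ℝ³`:
`𝓔f(t,x) = ∫_{ℝ²} e^{i(tξ₁ξ₂ + x·ξ)} f(ξ) dξ`. -/
noncomputable def extOp (f : ℝ × ℝ → ℂ) (p : ℝ × ℝ × ℝ) : ℂ :=
  ∫ ξ : ℝ × ℝ,
    Complex.exp (Complex.I * (p.1 * ξ.1 * ξ.2 + p.2.1 * ξ.1 + p.2.2 * ξ.2 : ℝ)) * f ξ

/-- Characteristic function of a set, valued in `ℂ`. -/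
noncomputable def chi (Ω : Set (ℝ × ℝ)) : ℝ × ℝ → ℂ := Ω.indicator fun _ => 1

/-- The axis-parallel unit square with lower-left corner `(a, b)`. -/
def unitSq (a b : ℝ) : Set (ℝ × ℝ) := Icc a (a + 1) ×ˢ Icc b (b + 1)

/-- Bilinear hypothesis BH(s,r) with constant `A`: a bilinear adjoint restriction estimate
`∥𝓔f·𝓔g∥_{L^s} ≤ A ∥f∥_{L^r} ∥g∥_{L^r}` whenever `f, g` are supported in `1 × 1`
axis-parallel squares whose projections onto each coordinate axis are separated by a
distance between `1` and `4` (equivalently, the corners satisfy `2 ≤ |aᵢ - bᵢ| ≤ 5`). -/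
def BH (s r A : ℝ) : Prop :=
  ∀ a₁ a₂ b₁ b₂ : ℝ, 2 ≤ |a₁ - b₁| → |a₁ - b₁| ≤ 5 → 2 ≤ |a₂ - b₂| → |a₂ - b₂| ≤ 5 →
    ∀ f g : ℝ × ℝ → ℂ,
      Function.support f ⊆ unitSq a₁ a₂ → Function.support g ⊆ unitSq b₁ b₂ →
      eLpNorm (fun p => extOp f p * extOp g p) (ENNReal.ofReal s) volume ≤
        ENNReal.ofReal A * eLpNorm f (ENNReal.ofReal r) volume *
          eLpNorm g (ENNReal.ofReal r) volume


/-- The dyadic interval `[m·2⁻ⁿ, (m+1)·2⁻ⁿ]`. -/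
def dyadicIcc (n m : ℤ) : Set ℝ := Icc ((m : ℝ) * 2 ^ (-n)) (((m : ℝ) + 1) * 2 ^ (-n))

/-- A tile in `𝓓_{j,k}`: a product of a dyadic interval of length `2⁻ʲ` with one of
length `2⁻ᵏ`. -/
def tile (j k m m' : ℤ) : Set (ℝ × ℝ) := dyadicIcc j m ×ˢ dyadicIcc k m'

/-- A dyadic number is one of the form `2ⁿ`, `n ∈ ℤ`. -/
def IsDyadic (x : ℝ) : Prop := ∃ n : ℤ, x = 2 ^ n

/-- The vertical fiber of `Ω ⊆ ℝ²` over `x`: `{η : (x, η) ∈ Ω}`. -/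
def vFiber (Ω : Set (ℝ × ℝ)) (x : ℝ) : Set ℝ := {y | (x, y) ∈ Ω}

/-- `Ω(K) = {ξ ∈ Ω : 2^{-K-1} ≤ 𝓗¹({η : (ξ₁,η) ∈ Ω}) ≤ 2^{-K+1}}`, the piece of `Ω` whose
vertical fibers have length about `2⁻ᴷ`. -/
noncomputable def fiberPiece (Ω : Set (ℝ × ℝ)) (K : ℕ) : Set (ℝ × ℝ) :=
  {ξ ∈ Ω | (2 : ℝ≥0∞) ^ (-(K : ℤ) - 1) ≤ volume (vFiber Ω ξ.1) ∧
    volume (vFiber Ω ξ.1) ≤ (2 : ℝ≥0∞) ^ (-(K : ℤ) + 1)}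

/-- `VargasBound s Ω c` says `∥𝓔χ_{Ω'}∥_{L^{2s}} ≤ c·|Ω|^{1/s'}` for every measurable
`Ω' ⊆ Ω` (here `1/s' = 1 - 1/s`). -/
def VargasBound (s : ℝ) (Ω : Set (ℝ × ℝ)) (c : ℝ) : Prop :=
  ∀ Ω' ⊆ Ω, MeasurableSet Ω' →
    eLpNorm (extOp (chi Ω')) (ENNReal.ofReal (2 * s)) volume ≤
      ENNReal.ofReal c * volume Ω ^ (1 - 1 / s)

/-- `𝓚(ε)`: the set of `K ≥ 0` for which `ε` is the smallest dyadic number such that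
`∥𝓔χ_{Ω'}∥_{L^{2s}} ≤ ε·|Ω(K)|^{1/s'}` holds for all measurable `Ω' ⊆ Ω(K)`. -/
def KsetOf (s : ℝ) (Ω : Set (ℝ × ℝ)) (ε : ℝ) : Set ℕ :=
  {K | VargasBound s (fiberPiece Ω K) ε ∧
    ∀ ε' : ℝ, IsDyadic ε' → ε' < ε → ¬ VargasBound s (fiberPiece Ω K) ε'}


noncomputable def ph (p : ℝ × ℝ × ℝ) (ξ : ℝ × ℝ) : ℂ :=
  Complex.exp (Complex.I * (p.1 * ξ.1 * ξ.2 + p.2.1 * ξ.1 + p.2.2 * ξ.2 : ℝ))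

lemma extOp_eq (f : ℝ × ℝ → ℂ) (p : ℝ × ℝ × ℝ) : extOp f p = ∫ ξ, ph p ξ * f ξ := rfl

lemma norm_ph (p : ℝ × ℝ × ℝ) (ξ : ℝ × ℝ) : ‖ph p ξ‖ = 1 := by
  unfold ph
  rw [mul_comm, Complex.norm_exp_ofReal_mul_I]

lemma continuous_ph : Continuous (fun z : (ℝ × ℝ × ℝ) × (ℝ × ℝ) => ph z.1 z.2) := by
  unfold ph; fun_prop

lemma integrable_ph {f : ℝ × ℝ → ℂ} (hf : Integrable f) (p : ℝ × ℝ × ℝ) :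
    Integrable (fun ξ => ph p ξ * f ξ) := by
  refine (integrable_norm_iff ?_).1 ?_
  · refine AEStronglyMeasurable.mul ?_ hf.1
    exact (continuous_ph.comp (by fun_prop : Continuous fun ξ : ℝ × ℝ => (p, ξ))).aestronglyMeasurable
  · simpa [norm_ph] using hf.norm

lemma continuous_extOp {f : ℝ × ℝ → ℂ} (hf : Integrable f) : Continuous (extOp f) := by
  show Continuous (fun p => ∫ ξ, ph p ξ * f ξ)
  refine continuous_of_dominated (bound := fun ξ => ‖f ξ‖) (fun p => (integrable_ph hf p).1) ?_ hf.norm ?_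
  · intro p; filter_upwards with ξ; simp [norm_ph]
  · filter_upwards with ξ
    exact (continuous_ph.comp (by fun_prop : Continuous fun p : ℝ × ℝ × ℝ => (p, ξ))).mul continuous_const

lemma extOp_sum {ι : Type*} (T : Finset ι) (f : ι → ℝ × ℝ → ℂ) (hf : ∀ i ∈ T, Integrable (f i))
    (p : ℝ × ℝ × ℝ) : extOp (fun ξ => ∑ i ∈ T, f i ξ) p = ∑ i ∈ T, extOp (f i) p := by
  simp only [extOp_eq, Finset.mul_sum]
  exact integral_finsetSum _ (fun i hi => integrable_ph (hf i hi) p)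

/-- dilation -/
def dil (a b : ℝ) (ξ : ℝ × ℝ) : ℝ × ℝ := (a * ξ.1, b * ξ.2)

lemma me_mul {a : ℝ} (ha : 0 < a) : MeasurableEmbedding (fun x : ℝ => a * x) :=
  (Homeomorph.mulLeft₀ a ha.ne').measurableEmbedding

lemma me_dil {a b : ℝ} (ha : 0 < a) (hb : 0 < b) : MeasurableEmbedding (dil a b) :=
  ((Homeomorph.mulLeft₀ a ha.ne').prodCongr (Homeomorph.mulLeft₀ b hb.ne')).measurableEmbedding

lemma map_dil {a b : ℝ} (ha : 0 < a) (hb : 0 < b) :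
    Measure.map (dil a b) (volume : Measure (ℝ × ℝ)) = ENNReal.ofReal ((a * b)⁻¹) • volume := by
  have h := Measure.map_prod_map (volume : Measure ℝ) (volume : Measure ℝ)
    (me_mul ha).measurable (me_mul hb).measurable
  have e : (dil a b) = Prod.map (fun x : ℝ => a * x) (fun x : ℝ => b * x) := rfl
  rw [e, Measure.volume_eq_prod, ← h, Real.map_volume_mul_left ha.ne', Real.map_volume_mul_left hb.ne',
    Measure.prod_smul_left, Measure.prod_smul_right, smul_smul, abs_of_pos (inv_pos.2 ha),
    abs_of_pos (inv_pos.2 hb), ← ENNReal.ofReal_mul (inv_pos.2 ha).le, mul_inv]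

/-- dilation in three variables -/
def dil3 (a b : ℝ) (p : ℝ × ℝ × ℝ) : ℝ × ℝ × ℝ := (a * b * p.1, a * p.2.1, b * p.2.2)

lemma me_dil3 {a b : ℝ} (ha : 0 < a) (hb : 0 < b) : MeasurableEmbedding (dil3 a b) :=
  ((Homeomorph.mulLeft₀ (a * b) (mul_pos ha hb).ne').prodCongr
    ((Homeomorph.mulLeft₀ a ha.ne').prodCongr (Homeomorph.mulLeft₀ b hb.ne'))).measurableEmbedding

lemma map_dil3 {a b : ℝ} (ha : 0 < a) (hb : 0 < b) :
    Measure.map (dil3 a b) (volume : Measure (ℝ × ℝ × ℝ)) =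
      ENNReal.ofReal (((a * b) ^ 2)⁻¹) • volume := by
  have h := Measure.map_prod_map (volume : Measure ℝ) (volume : Measure (ℝ × ℝ))
    (me_mul (mul_pos ha hb)).measurable (me_dil ha hb).measurable
  have e : (dil3 a b) = Prod.map (fun x : ℝ => a * b * x) (dil a b) := rfl
  rw [e, Measure.volume_eq_prod, ← h, Real.map_volume_mul_left (mul_pos ha hb).ne', map_dil ha hb,
    Measure.prod_smul_left, Measure.prod_smul_right, smul_smul,
    abs_of_pos (inv_pos.2 (mul_pos ha hb)),
    ← ENNReal.ofReal_mul (inv_pos.2 (mul_pos ha hb)).le, ← mul_inv, sq]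

lemma extOp_dil {a b : ℝ} (ha : 0 < a) (hb : 0 < b) (f : ℝ × ℝ → ℂ) (p : ℝ × ℝ × ℝ) :
    extOp f p = ((a * b : ℝ) : ℂ) * extOp (f ∘ dil a b) (dil3 a b p) := by
  have h1 : extOp (f ∘ dil a b) (dil3 a b p) = ∫ ξ, (fun η => ph p η * f η) (dil a b ξ) := by
    rw [extOp_eq]
    congr 1; ext ξ
    simp only [Function.comp, dil, dil3, ph]
    congr 3; push_cast; ring
  rw [h1, ← (me_dil ha hb).integral_map (fun η => ph p η * f η), map_dil ha hb, integral_smul_measure, ← extOp_eq,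
    ENNReal.toReal_ofReal (inv_pos.2 (mul_pos ha hb)).le, Complex.real_smul]
  have : ((a * b : ℝ) : ℂ) ≠ 0 := by exact_mod_cast (mul_pos ha hb).ne'
  rw [Complex.ofReal_inv, mul_inv_cancel_left₀ this]

lemma eLpNorm_dil {a b : ℝ} (ha : 0 < a) (hb : 0 < b) (f : ℝ × ℝ → ℂ) {r : ℝ} (hr : 0 < r) :
    eLpNorm (f ∘ dil a b) (ENNReal.ofReal r) volume =
      ENNReal.ofReal ((a * b) ^ (-(1 / r))) * eLpNorm f (ENNReal.ofReal r) volume := by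
  have hab := mul_pos ha hb
  rw [← (me_dil ha hb).eLpNorm_map_measure, map_dil ha hb,
    eLpNorm_smul_measure_of_ne_zero (by positivity), ENNReal.toReal_div,
    ENNReal.toReal_ofReal hr.le, ENNReal.ofReal_rpow_of_pos (by positivity), smul_eq_mul,
    Real.inv_rpow hab.le, Real.rpow_neg hab.le]
  simp

lemma eLpNorm_dil3 {a b : ℝ} (ha : 0 < a) (hb : 0 < b) (f : ℝ × ℝ × ℝ → ℂ) {r : ℝ} (hr : 0 < r) :
    eLpNorm (f ∘ dil3 a b) (ENNReal.ofReal r) volume =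
      ENNReal.ofReal ((a * b) ^ (-(2 / r))) * eLpNorm f (ENNReal.ofReal r) volume := by
  have hab := mul_pos ha hb
  rw [← (me_dil3 ha hb).eLpNorm_map_measure, map_dil3 ha hb,
    eLpNorm_smul_measure_of_ne_zero (by positivity), ENNReal.toReal_div,
    ENNReal.toReal_ofReal hr.le, ENNReal.ofReal_rpow_of_pos (by positivity), smul_eq_mul,
    Real.inv_rpow (by positivity), Real.rpow_neg hab.le]
  congr 3
  rw [← Real.rpow_natCast, ← Real.rpow_mul hab.le]
  congr 1
  simp [div_eq_mul_inv]

lemma BH_pos {s r A : ℝ} (hr : r < s / (s - 1)) (hs : 1 < s) (h : BH s r A) :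
    ∃ r' : ℝ, 0 < r' ∧ r' < s / (s - 1) ∧ BH s r' |A| := by
  by_cases h0 : 0 < r
  · refine ⟨r, h0, hr, fun a₁ a₂ b₁ b₂ h1 h2 h3 h4 f g hf hg => (h a₁ a₂ b₁ b₂ h1 h2 h3 h4 f g hf hg).trans ?_⟩
    gcongr
    exact le_abs_self A
  · have : 0 < s / (s - 1) := div_pos (by linarith) (by linarith)
    refine ⟨s / (s - 1) / 2, by positivity, by linarith,
      fun a₁ a₂ b₁ b₂ h1 h2 h3 h4 f g hf hg => (h a₁ a₂ b₁ b₂ h1 h2 h3 h4 f g hf hg).trans ?_⟩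
    rw [ENNReal.ofReal_of_nonpos (not_lt.1 h0)]
    simp

/-- rectangle with corner (u,v) sides a b -/
def rect (a b u v : ℝ) : Set (ℝ × ℝ) := Icc u (u + a) ×ˢ Icc v (v + b)

lemma eLpNorm_le_of_bd {f : ℝ × ℝ → ℂ} {M e r : ℝ} (hM : 0 ≤ M) (hr : 0 < r) {E : Set (ℝ × ℝ)}
    (hE : MeasurableSet E) (he : volume E ≤ ENNReal.ofReal e) (he0 : 0 ≤ e)
    (hf : ∀ ξ, ‖f ξ‖ ≤ M) (hf0 : ∀ ξ, f ξ ≠ 0 → ξ ∈ E) :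
    eLpNorm f (ENNReal.ofReal r) volume ≤ ENNReal.ofReal (M * e ^ (1 / r)) := by
  calc eLpNorm f (ENNReal.ofReal r) volume
      ≤ eLpNorm (E.indicator fun _ => M) (ENNReal.ofReal r) volume := by
        refine eLpNorm_mono fun ξ => ?_
        by_cases h : ξ ∈ E
        · rw [indicator_of_mem h, Real.norm_of_nonneg hM]; exact hf ξ
        · have : f ξ = 0 := by by_contra h'; exact h (hf0 ξ h')
          simp [this]
    _ = ENNReal.ofReal M * volume E ^ (1 / r) := by
        rw [eLpNorm_indicator_const hE (by simpa using hr) (by simp), ENNReal.toReal_ofReal hr.le,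
          Real.enorm_of_nonneg hM]
    _ ≤ ENNReal.ofReal M * ENNReal.ofReal e ^ (1 / r) := by gcongr
    _ = _ := by
        rw [ENNReal.ofReal_rpow_of_nonneg he0 (by positivity), ← ENNReal.ofReal_mul hM]

lemma abs_div_sub {a u v : ℝ} (ha : 0 < a) : |u / a - v / a| = |u - v| / a := by
  rw [← sub_div, abs_div, abs_of_pos ha]

lemma dil_supp {a b u v : ℝ} (ha : 0 < a) (hb : 0 < b) {f : ℝ × ℝ → ℂ}
    (hf : ∀ ξ, f ξ ≠ 0 → ξ ∈ rect a b u v) :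
    Function.support (f ∘ dil a b) ⊆ unitSq (u / a) (v / b) := by
  intro ξ hξ
  have h := hf _ hξ
  simp only [rect, dil, mem_prod, mem_Icc] at h
  simp only [unitSq, mem_prod, mem_Icc]
  refine ⟨⟨?_, ?_⟩, ?_, ?_⟩
  · rw [div_le_iff₀ ha]; linarith
  · have : u / a * a = u := div_mul_cancel₀ u ha.ne'
    nlinarith
  · rw [div_le_iff₀ hb]; linarith
  · have : v / b * b = v := div_mul_cancel₀ v hb.ne'
    nlinarith

lemma scaledBH {s r A : ℝ} (hs : 1 < s) (hr : 0 < r) (hA : 0 ≤ A) (h : BH s r A) {a b u v u' v' : ℝ}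
    (ha : 0 < a) (hb : 0 < b)
    (h1 : 2 * a ≤ |u - u'|) (h2 : |u - u'| ≤ 5 * a) (h3 : 2 * b ≤ |v - v'|) (h4 : |v - v'| ≤ 5 * b)
    {f g : ℝ × ℝ → ℂ} {M e e' : ℝ} (hM : 0 ≤ M) {E E' : Set (ℝ × ℝ)} (hE : MeasurableSet E)
    (hE' : MeasurableSet E') (he : volume E ≤ ENNReal.ofReal e) (he' : volume E' ≤ ENNReal.ofReal e')
    (he0 : 0 ≤ e) (he0' : 0 ≤ e') (hf : ∀ ξ, ‖f ξ‖ ≤ M) (hg : ∀ ξ, ‖g ξ‖ ≤ M)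
    (hfE : ∀ ξ, f ξ ≠ 0 → ξ ∈ E) (hgE : ∀ ξ, g ξ ≠ 0 → ξ ∈ E')
    (hfR : ∀ ξ, f ξ ≠ 0 → ξ ∈ rect a b u v) (hgR : ∀ ξ, g ξ ≠ 0 → ξ ∈ rect a b u' v') :
    eLpNorm (fun p => extOp f p * extOp g p) (ENNReal.ofReal s) volume ≤
      ENNReal.ofReal (A * M ^ 2 * ((a * b) ^ (2 * (1 - 1 / s) - 2 / r) * (e * e') ^ (1 / r))) := by
  have hab := mul_pos ha hb
  have key := h (u / a) (v / b) (u' / a) (v' / b)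
    (by rw [abs_div_sub ha, le_div_iff₀ ha]; linarith) (by rw [abs_div_sub ha, div_le_iff₀ ha]; linarith)
    (by rw [abs_div_sub hb, le_div_iff₀ hb]; linarith) (by rw [abs_div_sub hb, div_le_iff₀ hb]; linarith)
    (f ∘ dil a b) (g ∘ dil a b) (dil_supp ha hb hfR) (dil_supp ha hb hgR)
  have e1 : (fun p => extOp f p * extOp g p) = (((a * b) ^ 2 : ℝ) : ℂ) •
      ((fun p => extOp (f ∘ dil a b) p * extOp (g ∘ dil a b) p) ∘ dil3 a b) := by
    ext p
    simp only [Pi.smul_apply, Function.comp_apply, smul_eq_mul]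
    rw [extOp_dil ha hb f, extOp_dil ha hb g]; push_cast; simp only [Function.comp_def]; ring
  rw [e1, eLpNorm_const_smul, eLpNorm_dil3 ha hb _ (by linarith : 0 < s)]
  rw [eLpNorm_dil ha hb _ hr, eLpNorm_dil ha hb _ hr] at key
  have hF := eLpNorm_le_of_bd hM hr hE he he0 hf hfE
  have hG := eLpNorm_le_of_bd hM hr hE' he' he0' hg hgE
  have e2 : ‖(((a * b) ^ 2 : ℝ) : ℂ)‖ₑ = ENNReal.ofReal ((a * b) ^ 2) := by
    rw [← ofReal_norm, Complex.norm_of_nonneg (by positivity)]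
  rw [e2]
  calc _ ≤ ENNReal.ofReal ((a * b) ^ 2) * (ENNReal.ofReal ((a * b) ^ (-(2 / s))) *
        (ENNReal.ofReal A * (ENNReal.ofReal ((a * b) ^ (-(1 / r))) * ENNReal.ofReal (M * e ^ (1 / r))) *
        (ENNReal.ofReal ((a * b) ^ (-(1 / r))) * ENNReal.ofReal (M * e' ^ (1 / r))))) := by
        gcongr
        exact key.trans (by gcongr)
    _ = _ := by
        rw [← ENNReal.ofReal_mul (by positivity), ← ENNReal.ofReal_mul (by positivity),
          ← ENNReal.ofReal_mul (by positivity), ← ENNReal.ofReal_mul (by positivity),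
          ← ENNReal.ofReal_mul (by positivity), ← ENNReal.ofReal_mul (by positivity)]
        congr 1
        have e3 : (a * b) ^ (2 * (1 - 1 / s) - 2 / r) =
            (a * b) ^ 2 * (a * b) ^ (-(2 / s)) * (a * b) ^ (-(1 / r)) * (a * b) ^ (-(1 / r)) := by
          rw [← Real.rpow_natCast, ← Real.rpow_add hab, ← Real.rpow_add hab, ← Real.rpow_add hab]
          congr 1; push_cast; ring
        rw [e3, Real.mul_rpow he0 he0']
        ring


/-- exponential probability measure -/
noncomputable def nuE : Measure ℝ :=
  (volume.restrict (Ioi 0)).withDensity (fun u => ENNReal.ofReal (Real.exp (-u)))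

lemma nuE_integral (g : ℝ → ℂ) : ∫ u, g u ∂nuE = ∫ u in Ioi 0, ((Real.exp (-u) : ℝ) : ℂ) * g u := by
  unfold nuE
  rw [integral_withDensity_eq_integral_toReal_smul (by fun_prop) (by simp)]
  congr 1; ext u
  rw [ENNReal.toReal_ofReal (Real.exp_pos _).le, Complex.real_smul]

instance nuE_prob : IsProbabilityMeasure nuE := by
  constructor
  unfold nuE
  rw [withDensity_apply _ MeasurableSet.univ, Measure.restrict_univ,
    ← ofReal_integral_eq_lintegral_ofReal, integral_exp_neg_Ioi]
  · simp
  · exact exp_neg_integrableOn_Ioi 0 one_pos |>.congr (by simp)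
  · filter_upwards with u using (Real.exp_pos _).le

lemma nuE_char (ζ : ℝ) : ∫ u, Complex.exp (Complex.I * (ζ * u : ℝ)) ∂nuE = 1 / (1 - Complex.I * ζ) := by
  rw [nuE_integral]
  have h : ∀ u : ℝ, ((Real.exp (-u) : ℝ) : ℂ) * Complex.exp (Complex.I * (ζ * u : ℝ)) =
      Complex.exp ((-1 + Complex.I * ζ) * u) := by
    intro u
    rw [Complex.ofReal_exp, ← Complex.exp_add]
    congr 1; push_cast; ring
  simp_rw [h]
  rw [integral_exp_mul_complex_Ioi (by simp)]
  have h1 : (-1 + Complex.I * ζ) ≠ 0 := fun h => by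
    have := congrArg Complex.re h; simp at this
  have h2 : (1 - Complex.I * ζ) ≠ 0 := fun h => by
    have := congrArg Complex.re h; simp at this
  simp
  field_simp
  ring

lemma summable_w : Summable (fun n : ℤ => 2 / (1 + 4 * (n : ℝ) ^ 2)) := by
  have h1 : Summable (fun n : ℤ => 2 * (1 / (n : ℝ) ^ 2) + (if n = 0 then (2 : ℝ) else 0)) := by
    refine ((Real.summable_one_div_int_pow.2 (by norm_num)).mul_left 2).add ?_
    refine summable_of_ne_finset_zero (s := {0}) ?_
    intro b hb; simp at hb; simp [hb]
  refine Summable.of_nonneg_of_le (fun n => by positivity) (fun n => ?_) h1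
  by_cases hn : n = 0
  · simp [hn]
  · have : (0 : ℝ) < (n : ℝ) ^ 2 := by positivity
    simp only [hn, if_false, add_zero]
    rw [← mul_div_assoc, mul_one]
    apply div_le_div_of_nonneg_left (by norm_num) this
    nlinarith

noncomputable def Wc : ℝ := ∑' n : ℤ, 2 / (1 + 4 * (n : ℝ) ^ 2)

lemma Wc_nonneg : 0 ≤ Wc := tsum_nonneg (fun n => by positivity)

lemma schur_w (T : Finset ℤ) (x : ℤ → ℝ) :
    ∑ k ∈ T, ∑ l ∈ T, x k * x l * (2 / (1 + 4 * ((k - l : ℤ) : ℝ) ^ 2)) ≤ Wc * ∑ k ∈ T, x k ^ 2 := by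
  set w : ℤ → ℝ := fun n => 2 / (1 + 4 * (n : ℝ) ^ 2) with hw
  have hw0 : ∀ n, 0 ≤ w n := fun n => by positivity
  have hsym : ∀ n, w (-n) = w n := fun n => by simp [hw]
  have hsum : ∀ k, ∑ l ∈ T, w (k - l) ≤ Wc := by
    intro k
    have : Summable (fun l => w (k - l)) := summable_w.comp_injective (sub_right_injective)
    refine (this.sum_le_tsum T (fun l _ => hw0 _)).trans (le_of_eq ?_)
    exact (Equiv.subLeft k).tsum_eq w
  have h1 : ∑ k ∈ T, ∑ l ∈ T, x k * x l * w (k - l) ≤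
      ∑ k ∈ T, ∑ l ∈ T, (x k ^ 2 / 2 * w (k - l) + x l ^ 2 / 2 * w (l - k)) := by
    refine Finset.sum_le_sum fun k _ => Finset.sum_le_sum fun l _ => ?_
    rw [← hsym (k - l), neg_sub]
    have := hw0 (l - k)
    nlinarith [mul_nonneg this (sq_nonneg (x k - x l))]
  refine h1.trans ?_
  simp_rw [Finset.sum_add_distrib]
  rw [Finset.sum_comm (f := fun k l => x l ^ 2 / 2 * w (l - k))]
  simp_rw [← Finset.mul_sum]
  have h2 : ∑ k ∈ T, x k ^ 2 / 2 * ∑ l ∈ T, w (k - l) ≤ ∑ k ∈ T, x k ^ 2 / 2 * Wc :=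
    Finset.sum_le_sum fun k _ => by gcongr; exact hsum k
  have h3 : ∑ k ∈ T, x k ^ 2 / 2 * Wc = Wc / 2 * ∑ k ∈ T, x k ^ 2 := by
    rw [Finset.mul_sum]; exact Finset.sum_congr rfl fun k _ => by ring
  linarith

/-- character -/
noncomputable def chr (x : ℝ) : ℂ := Complex.exp (Complex.I * (x : ℝ))

lemma norm_chr (x : ℝ) : ‖chr x‖ = 1 := by
  unfold chr; rw [mul_comm, Complex.norm_exp_ofReal_mul_I]
lemma continuous_chr : Continuous chr := by unfold chr; fun_prop
lemma chr_add (x y : ℝ) : chr (x + y) = chr x * chr y := by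
  unfold chr; rw [← Complex.exp_add]; congr 1; push_cast; ring
lemma conj_chr (x : ℝ) : (starRingEnd ℂ) (chr x) = chr (-x) := by
  unfold chr; rw [← Complex.exp_conj]; simp

lemma nuE_chr (ζ : ℝ) : ∫ u, chr (ζ * u) ∂nuE = 1 / (1 - Complex.I * ζ) := nuE_char ζ

lemma integrable_chr (ζ : ℝ) : Integrable (fun u => chr (ζ * u)) nuE := by
  refine Integrable.of_bound (C := 1) ?_ ?_
  · exact (continuous_chr.comp (by fun_prop)).aestronglyMeasurable
  · filter_upwards with u; rw [norm_chr]

lemma sum_two (n : ℝ) : 1 / (1 - Complex.I * n) + 1 / (1 - Complex.I * ((-n : ℝ) : ℂ)) =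
    ((2 / (1 + n ^ 2) : ℝ) : ℂ) := by
  have h1 : (1 + Complex.I * n) ≠ 0 := fun h => by
    have := congrArg Complex.re h; simp at this
  have h2 : (1 - Complex.I * n) ≠ 0 := fun h => by
    have := congrArg Complex.re h; simp at this
  have h3 : (1 + (n : ℂ) ^ 2) = (1 - Complex.I * n) * (1 + Complex.I * n) := by
    ring_nf; simp
  push_cast
  rw [h3, mul_neg, sub_neg_eq_add]
  field_simp
  ring

/-- Parseval-type bound for exponential sums with frequencies `2k+d`. -/
lemma parseval1 (T : Finset ℤ) (a : ℤ → ℂ) (d : ℝ) :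
    ∫⁻ u, ‖∑ k ∈ T, a k * chr (-(2 * k + d) * u)‖ₑ ^ (2 : ℝ) ∂nuE ≤
      ENNReal.ofReal Wc * ∑ k ∈ T, ‖a k‖ₑ ^ (2 : ℝ) := by
  set S : ℝ → ℂ := fun u => ∑ k ∈ T, a k * chr (-(2 * k + d) * u) with hS
  have hSc : Continuous S := by
    rw [hS]
    refine continuous_finsetSum _ fun k _ => continuous_const.mul (continuous_chr.comp (by fun_prop))
  have hSb : ∀ u, ‖S u‖ ≤ ∑ k ∈ T, ‖a k‖ := fun u => by
    refine (norm_sum_le _ _).trans (Finset.sum_le_sum fun k _ => ?_)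
    rw [norm_mul, norm_chr, mul_one]
  have hInt0 : ∀ c : ℝ, Integrable (fun u => ‖S (c * u)‖ ^ 2) nuE := fun c => by
    refine Integrable.of_bound (C := (∑ k ∈ T, ‖a k‖) ^ 2) ?_ ?_
    · exact (by fun_prop : Continuous (fun u => ‖S (c * u)‖ ^ 2)).aestronglyMeasurable
    · filter_upwards with u
      rw [Real.norm_of_nonneg (by positivity)]
      gcongr; exact hSb _
  -- expansion
  have hexp : ∀ u, ((‖S u‖ ^ 2 : ℝ) : ℂ) =
      ∑ k ∈ T, ∑ l ∈ T, a k * (starRingEnd ℂ) (a l) * chr (-(2 * (k - l : ℤ)) * u) := by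
    intro u
    rw [Complex.ofReal_pow, ← Complex.mul_conj', hS]
    simp only [map_sum, map_mul]
    rw [Finset.sum_mul_sum]
    refine Finset.sum_congr rfl fun k _ => Finset.sum_congr rfl fun l _ => ?_
    rw [conj_chr]
    have : chr (-(2 * (k - l : ℤ)) * u) = chr (-(2 * k + d) * u) * chr (-(-(2 * l + d) * u)) := by
      rw [← chr_add]; congr 1; push_cast; ring
    rw [this]; ring
  have hI : ∀ c : ℝ, ((∫ u, ‖S (c * u)‖ ^ 2 ∂nuE : ℝ) : ℂ) =
      ∑ k ∈ T, ∑ l ∈ T, a k * (starRingEnd ℂ) (a l) *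
        (1 / (1 - Complex.I * ((-(2 * (k - l : ℤ)) * c : ℝ) : ℂ))) := by
    intro c
    rw [← integral_complex_ofReal]
    simp_rw [hexp]
    rw [integral_finsetSum]
    · refine Finset.sum_congr rfl fun k _ => ?_
      rw [integral_finsetSum]
      · refine Finset.sum_congr rfl fun l _ => ?_
        rw [integral_const_mul, ← nuE_chr]
        simp_rw [mul_assoc]
      · intro l _
        refine Integrable.const_mul ?_ _
        simpa only [mul_assoc] using integrable_chr (-(2 * (k - l : ℤ)) * c)
    · intro k _
      refine integrable_finsetSum _ fun l _ => Integrable.const_mul ?_ _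
      simpa only [mul_assoc] using integrable_chr (-(2 * (k - l : ℤ)) * c)
  have hsum : (∫ u, ‖S (1 * u)‖ ^ 2 ∂nuE) + (∫ u, ‖S ((-1) * u)‖ ^ 2 ∂nuE) ≤
      Wc * ∑ k ∈ T, ‖a k‖ ^ 2 := by
    have h0 : (((∫ u, ‖S (1 * u)‖ ^ 2 ∂nuE) + (∫ u, ‖S ((-1) * u)‖ ^ 2 ∂nuE) : ℝ) : ℂ) =
      ∑ k ∈ T, ∑ l ∈ T, a k * (starRingEnd ℂ) (a l) *
        ((2 / (1 + 4 * ((k - l : ℤ) : ℝ) ^ 2) : ℝ) : ℂ) := by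
      rw [Complex.ofReal_add, hI, hI, ← Finset.sum_add_distrib]
      refine Finset.sum_congr rfl fun k _ => ?_
      rw [← Finset.sum_add_distrib]
      refine Finset.sum_congr rfl fun l _ => ?_
      rw [← mul_add]
      congr 1
      have := sum_two (-(2 * ((k - l : ℤ) : ℝ)))
      rw [mul_one, mul_neg_one, this]
      congr 2; ring
    have hn : 0 ≤ (∫ u, ‖S (1 * u)‖ ^ 2 ∂nuE) + (∫ u, ‖S ((-1) * u)‖ ^ 2 ∂nuE) :=
      add_nonneg (integral_nonneg fun u => by positivity) (integral_nonneg fun u => by positivity)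
    rw [← Complex.norm_of_nonneg hn, h0]
    refine (norm_sum_le _ _).trans (le_trans (Finset.sum_le_sum fun k _ => norm_sum_le _ _) ?_)
    refine le_trans (le_of_eq ?_) (schur_w T (fun k => ‖a k‖))
    refine Finset.sum_congr rfl fun k _ => Finset.sum_congr rfl fun l _ => ?_
    rw [norm_mul, norm_mul, RCLike.norm_conj, Complex.norm_of_nonneg (by positivity)]
  have hn2 : 0 ≤ (∫ u, ‖S ((-1) * u)‖ ^ 2 ∂nuE) := integral_nonneg fun u => by positivity
  have hle : ∫ u, ‖S (1 * u)‖ ^ 2 ∂nuE ≤ Wc * ∑ k ∈ T, ‖a k‖ ^ 2 := by linarith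
  have hsq : ∀ z : ℂ, ‖z‖ₑ ^ (2 : ℝ) = ENNReal.ofReal (‖z‖ ^ 2) := fun z => by
    rw [← ofReal_norm, ENNReal.ofReal_rpow_of_nonneg (norm_nonneg _) (by norm_num)]
    norm_num
  simp_rw [hsq]
  rw [← ENNReal.ofReal_sum_of_nonneg (fun _ _ => by positivity), ← ENNReal.ofReal_mul Wc_nonneg,
    ← ofReal_integral_eq_lintegral_ofReal]
  · apply ENNReal.ofReal_le_ofReal; simp only [one_mul] at hle; exact hle
  · have := hInt0 1; simp only [one_mul] at this; exact this
  · filter_upwards with u; positivity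


lemma ennreal_rpow_sum_le {ι : Type*} (T : Finset ι) (x : ι → ℝ≥0∞) {p : ℝ} (hp0 : 0 < p) (hp : p ≤ 1) :
    (∑ i ∈ T, x i) ^ p ≤ ∑ i ∈ T, x i ^ p := by
  classical
  induction T using Finset.induction_on with
  | empty => simp [hp0]
  | insert i T hi ih =>
    rw [Finset.sum_insert hi, Finset.sum_insert hi]
    exact (ENNReal.rpow_add_le_add_rpow _ _ hp0.le hp).trans (by gcongr)

lemma parseval2 (T₁ T₂ : Finset ℤ) (a : ℤ → ℤ → ℂ) (d₁ d₂ : ℝ) :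
    ∫⁻ u : ℝ × ℝ, ‖∑ k ∈ T₁, ∑ j ∈ T₂, chr (-(2 * k + d₁) * u.1) * chr (-(2 * j + d₂) * u.2) * a k j‖ₑ ^ (2 : ℝ)
      ∂(nuE.prod nuE) ≤
      ENNReal.ofReal Wc ^ (2 : ℝ) * ∑ k ∈ T₁, ∑ j ∈ T₂, ‖a k j‖ₑ ^ (2 : ℝ) := by
  have hm : Measurable (fun u : ℝ × ℝ => ‖∑ k ∈ T₁, ∑ j ∈ T₂, chr (-(2 * k + d₁) * u.1) *
      chr (-(2 * j + d₂) * u.2) * a k j‖ₑ ^ (2 : ℝ)) := by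
    have : Continuous (fun u : ℝ × ℝ => ∑ k ∈ T₁, ∑ j ∈ T₂, chr (-(2 * k + d₁) * u.1) *
      chr (-(2 * j + d₂) * u.2) * a k j) := by
      refine continuous_finsetSum _ fun k _ => continuous_finsetSum _ fun j _ => ?_
      exact ((continuous_chr.comp (by fun_prop)).mul (continuous_chr.comp (by fun_prop))).mul continuous_const
    exact this.measurable.enorm.pow_const _
  rw [lintegral_prod_symm _ hm.aemeasurable]
  have h1 : ∀ v : ℝ, ∫⁻ u, ‖∑ k ∈ T₁, ∑ j ∈ T₂, chr (-(2 * k + d₁) * u) *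
      chr (-(2 * j + d₂) * v) * a k j‖ₑ ^ (2 : ℝ) ∂nuE ≤
      ENNReal.ofReal Wc * ∑ k ∈ T₁, ‖∑ j ∈ T₂, a k j * chr (-(2 * j + d₂) * v)‖ₑ ^ (2 : ℝ) := by
    intro v
    refine le_trans (le_of_eq ?_) (parseval1 T₁ (fun k => ∑ j ∈ T₂, a k j * chr (-(2 * j + d₂) * v)) d₁)
    congr 1; ext u; congr 2
    refine Finset.sum_congr rfl fun k _ => ?_
    rw [Finset.sum_mul]
    exact Finset.sum_congr rfl fun j _ => by ring
  refine (lintegral_mono h1).trans ?_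
  have hmk : ∀ k, Measurable (fun v : ℝ => ‖∑ j ∈ T₂, a k j * chr (-(2 * j + d₂) * v)‖ₑ ^ (2 : ℝ)) := by
    intro k
    have : Continuous (fun v : ℝ => ∑ j ∈ T₂, a k j * chr (-(2 * j + d₂) * v)) :=
      continuous_finsetSum _ fun j _ => continuous_const.mul (continuous_chr.comp (by fun_prop))
    exact this.measurable.enorm.pow_const _
  rw [lintegral_const_mul _ (Finset.measurable_sum _ fun k _ => hmk k), lintegral_finsetSum _ fun k _ => hmk k]
  have e : ENNReal.ofReal Wc ^ (2 : ℝ) = ENNReal.ofReal Wc * ENNReal.ofReal Wc := by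
    rw [ENNReal.rpow_two, sq]
  rw [e, mul_assoc]
  refine mul_le_mul' le_rfl ?_
  rw [Finset.mul_sum]
  exact Finset.sum_le_sum fun k _ => parseval1 T₂ (a k) d₂

lemma parseval_s {s : ℝ} (hs1 : 1 ≤ s) (hs2 : s ≤ 2) (T₁ T₂ : Finset ℤ) (a : ℤ → ℤ → ℂ) (d₁ d₂ : ℝ) :
    ∫⁻ u : ℝ × ℝ, ‖∑ k ∈ T₁, ∑ j ∈ T₂, chr (-(2 * k + d₁) * u.1) * chr (-(2 * j + d₂) * u.2) * a k j‖ₑ ^ s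
      ∂(nuE.prod nuE) ≤
      ENNReal.ofReal Wc ^ s * ∑ k ∈ T₁, ∑ j ∈ T₂, ‖a k j‖ₑ ^ s := by
  have hs0 : 0 < s := by linarith
  have hc : Continuous (fun u : ℝ × ℝ => ∑ k ∈ T₁, ∑ j ∈ T₂, chr (-(2 * k + d₁) * u.1) *
      chr (-(2 * j + d₂) * u.2) * a k j) := by
      refine continuous_finsetSum _ fun k _ => continuous_finsetSum _ fun j _ => ?_
      exact ((continuous_chr.comp (by fun_prop)).mul (continuous_chr.comp (by fun_prop))).mul continuous_const
  have h := eLpNorm'_le_eLpNorm'_of_exponent_le hs0 hs2 (nuE.prod nuE) hc.aestronglyMeasurable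
  rw [eLpNorm'_eq_lintegral_enorm, eLpNorm'_eq_lintegral_enorm] at h
  have h2 := ENNReal.rpow_le_rpow h hs0.le
  rw [← ENNReal.rpow_mul, one_div_mul_cancel hs0.ne', ENNReal.rpow_one, ← ENNReal.rpow_mul] at h2
  refine h2.trans ?_
  calc _ ≤ (ENNReal.ofReal Wc ^ (2 : ℝ) * ∑ k ∈ T₁, ∑ j ∈ T₂, ‖a k j‖ₑ ^ (2 : ℝ)) ^ (1 / 2 * s) := by
        gcongr; exact parseval2 T₁ T₂ a d₁ d₂
    _ = ENNReal.ofReal Wc ^ s * (∑ k ∈ T₁, ∑ j ∈ T₂, ‖a k j‖ₑ ^ (2 : ℝ)) ^ (1 / 2 * s) := by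
        rw [ENNReal.mul_rpow_of_nonneg _ _ (by positivity), ← ENNReal.rpow_mul]
        congr 2; ring
    _ ≤ _ := by
        gcongr
        refine (ennreal_rpow_sum_le _ _ (by positivity) (by linarith)).trans ?_
        refine Finset.sum_le_sum fun k _ => ?_
        refine (ennreal_rpow_sum_le _ _ (by positivity) (by linarith)).trans ?_
        refine Finset.sum_le_sum fun j _ => ?_
        rw [← ENNReal.rpow_mul]
        exact le_of_eq (by congr 1; ring)

lemma shift_mink {s : ℝ} (hs1 : 1 ≤ s) (S : (ℝ × ℝ × ℝ) → (ℝ × ℝ) → ℂ) (sh : (ℝ × ℝ) → (ℝ × ℝ × ℝ))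
    (hSc : Continuous (fun z : (ℝ × ℝ × ℝ) × (ℝ × ℝ) => S z.1 z.2)) (hshc : Continuous sh)
    (H : ℝ × ℝ × ℝ → ℂ) (hH2 : ∀ p, H p = ∫ u, S (p + sh u) u ∂(nuE.prod nuE)) :
    ∫⁻ p, ‖H p‖ₑ ^ s ≤ ∫⁻ p, ∫⁻ u, ‖S p u‖ₑ ^ s ∂(nuE.prod nuE) := by
  have hs0 : 0 < s := by linarith
  have hSc2 : Continuous (fun z : (ℝ × ℝ × ℝ) × (ℝ × ℝ) => S (z.1 + sh z.2) z.2) :=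
    hSc.comp ((continuous_fst.add (hshc.comp continuous_snd)).prodMk continuous_snd)
  have hJ : ∀ p, ‖H p‖ₑ ^ s ≤ ∫⁻ u, ‖S (p + sh u) u‖ₑ ^ s ∂(nuE.prod nuE) := by
    intro p
    have hcp : Continuous (fun u => S (p + sh u) u) :=
      hSc2.comp (continuous_const.prodMk continuous_id)
    have h := eLpNorm'_le_eLpNorm'_of_exponent_le one_pos hs1 (nuE.prod nuE) hcp.aestronglyMeasurable
    rw [eLpNorm'_eq_lintegral_enorm, eLpNorm'_eq_lintegral_enorm] at h
    simp only [ENNReal.rpow_one, one_div_one] at h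
    have h2 := ENNReal.rpow_le_rpow h hs0.le
    rw [← ENNReal.rpow_mul, one_div_mul_cancel hs0.ne', ENNReal.rpow_one] at h2
    refine le_trans ?_ h2
    gcongr
    rw [hH2]
    exact enorm_integral_le_lintegral_enorm _
  have hm1 : AEMeasurable (fun z : (ℝ × ℝ × ℝ) × (ℝ × ℝ) => ‖S (z.1 + sh z.2) z.2‖ₑ ^ s)
      ((volume : Measure (ℝ × ℝ × ℝ)).prod (nuE.prod nuE)) :=
    (hSc2.measurable.enorm.pow_const s).aemeasurable
  have hm2 : AEMeasurable (fun z : (ℝ × ℝ × ℝ) × (ℝ × ℝ) => ‖S z.1 z.2‖ₑ ^ s)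
      ((volume : Measure (ℝ × ℝ × ℝ)).prod (nuE.prod nuE)) :=
    (hSc.measurable.enorm.pow_const s).aemeasurable
  calc ∫⁻ p, ‖H p‖ₑ ^ s ≤ ∫⁻ p, ∫⁻ u, ‖S (p + sh u) u‖ₑ ^ s ∂(nuE.prod nuE) := lintegral_mono hJ
    _ = ∫⁻ u, (∫⁻ p, ‖S (p + sh u) u‖ₑ ^ s) ∂(nuE.prod nuE) := lintegral_lintegral_swap hm1
    _ = ∫⁻ u, (∫⁻ p, ‖S p u‖ₑ ^ s) ∂(nuE.prod nuE) := by
        haveI : (volume : Measure (ℝ × ℝ × ℝ)).IsAddHaarMeasure :=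
          Measure.prod.instIsAddHaarMeasure (volume : Measure ℝ) (volume : Measure (ℝ × ℝ))
        haveI : (volume : Measure (ℝ × ℝ × ℝ)).IsAddRightInvariant := inferInstance
        congr 1; ext u
        exact lintegral_add_right_eq_self (fun p => ‖S p u‖ₑ ^ s) (sh u)
    _ = ∫⁻ p, ∫⁻ u, ‖S p u‖ₑ ^ s ∂(nuE.prod nuE) := (lintegral_lintegral_swap hm2).symm

lemma ortho {s : ℝ} (hs1 : 1 ≤ s) (hs2 : s ≤ 2) (T₁ T₂ : Finset ℤ) (d₁ d₂ σ τ : ℝ)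
    (G : ℤ → ℤ → ℝ × ℝ × ℝ → ℂ) (hGc : ∀ k j, Continuous (G k j)) (hGb : ∀ k j, ∃ B, ∀ p, ‖G k j p‖ ≤ B)
    (H : ℝ × ℝ × ℝ → ℂ)
    (hH : ∀ p, H p = ∑ k ∈ T₁, ∑ j ∈ T₂, ∫ u : ℝ × ℝ, chr (-(2 * k + d₁) * u.1) * chr (-(2 * j + d₂) * u.2) *
      G k j (p.1, p.2.1 + σ * u.1, p.2.2 + τ * u.2) ∂(nuE.prod nuE)) :
    ∫⁻ p, ‖H p‖ₑ ^ s ≤ ENNReal.ofReal Wc ^ s * ∑ k ∈ T₁, ∑ j ∈ T₂, ∫⁻ p, ‖G k j p‖ₑ ^ s := by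
  have hs0 : 0 < s := by linarith
  have hcc : ∀ k j : ℤ, Continuous (fun u : ℝ × ℝ => chr (-(2 * k + d₁) * u.1) * chr (-(2 * j + d₂) * u.2)) :=
    fun k j => (continuous_chr.comp (continuous_const.mul continuous_fst)).mul
      (continuous_chr.comp (continuous_const.mul continuous_snd))
  have hadd : ∀ (p : ℝ × ℝ × ℝ) (u : ℝ × ℝ), (p.1, p.2.1 + σ * u.1, p.2.2 + τ * u.2)
      = p + ((0, σ * u.1, τ * u.2) : ℝ × ℝ × ℝ) := by
    intro p u; ext <;> simp
  have hshc : Continuous (fun u : ℝ × ℝ => ((0, σ * u.1, τ * u.2) : ℝ × ℝ × ℝ)) := by fun_prop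
  have hi : ∀ (p : ℝ × ℝ × ℝ) (k j : ℤ), Integrable (fun u : ℝ × ℝ => chr (-(2 * k + d₁) * u.1) *
      chr (-(2 * j + d₂) * u.2) * G k j (p + ((0, σ * u.1, τ * u.2) : ℝ × ℝ × ℝ))) (nuE.prod nuE) := by
    intro p k j
    obtain ⟨B, hB⟩ := hGb k j
    refine Integrable.of_bound (C := B) ?_ ?_
    · exact ((hcc k j).mul ((hGc k j).comp (continuous_const.add hshc))).aestronglyMeasurable
    · filter_upwards with u
      rw [norm_mul, norm_mul, norm_chr, norm_chr, one_mul, one_mul]; exact hB _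
  refine (shift_mink hs1 (fun p u => ∑ k ∈ T₁, ∑ j ∈ T₂,
    chr (-(2 * k + d₁) * u.1) * chr (-(2 * j + d₂) * u.2) * G k j p)
    (fun u => (0, σ * u.1, τ * u.2)) ?_ hshc H ?_).trans ?_
  · refine continuous_finsetSum _ fun k _ => continuous_finsetSum _ fun j _ => ?_
    exact ((hcc k j).comp continuous_snd).mul ((hGc k j).comp continuous_fst)
  · intro p
    rw [hH p]
    simp only [hadd]
    rw [integral_finsetSum _ fun k _ => integrable_finsetSum _ fun j _ => hi p k j]
    refine Finset.sum_congr rfl fun k _ => ?_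
    rw [integral_finsetSum _ fun j _ => hi p k j]
  · refine (lintegral_mono fun p => parseval_s hs1 hs2 T₁ T₂ (fun k j => G k j p) d₁ d₂).trans (le_of_eq ?_)
    have hmk : ∀ k j, Measurable (fun p => ‖G k j p‖ₑ ^ s) := fun k j =>
      (hGc k j).measurable.enorm.pow_const s
    rw [lintegral_const_mul _ (Finset.measurable_sum _ fun k _ => Finset.measurable_sum _ fun j _ => hmk k j),
      lintegral_finsetSum _ fun k _ => Finset.measurable_sum _ fun j _ => hmk k j]
    congr 1
    refine Finset.sum_congr rfl fun k _ => ?_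
    rw [lintegral_finsetSum _ fun j _ => hmk k j]


lemma repro {Z : Type*} [MeasurableSpace Z] (μ : Measure Z) [SFinite μ]
    (z1 z2 : Z → ℝ) (h1 : Measurable z1) (h2 : Measurable z2)
    (Ψ : Z → ℂ) (hΨ : Integrable (fun z => (1 - Complex.I * z1 z) * (1 - Complex.I * z2 z) * Ψ z) μ) :
    ∫ z, Ψ z ∂μ = ∫ u : ℝ × ℝ, (∫ z, chr (z1 z * u.1) * chr (z2 z * u.2) *
      ((1 - Complex.I * z1 z) * (1 - Complex.I * z2 z) * Ψ z) ∂μ) ∂(nuE.prod nuE) := by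
  have hne : ∀ x : ℝ, (1 - Complex.I * x : ℂ) ≠ 0 := by
    intro x h
    have := congrArg Complex.re h
    simp at this
  rw [integral_integral_swap]
  · congr 1; ext z
    rw [integral_mul_const]
    have := integral_prod_mul (μ := nuE) (ν := nuE) (fun u => chr (z1 z * u)) (fun u => chr (z2 z * u))
    rw [this, nuE_chr, nuE_chr]
    have a := hne (z1 z)
    have b := hne (z2 z)
    field_simp
  · have hm : Measurable (fun w : (ℝ × ℝ) × Z => chr (z1 w.2 * w.1.1) * chr (z2 w.2 * w.1.2)) := by
      have hc := continuous_chr.measurable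
      exact (hc.comp ((h1.comp measurable_snd).mul (measurable_fst.comp measurable_fst))).mul
        (hc.comp ((h2.comp measurable_snd).mul (measurable_snd.comp measurable_fst)))
    have hi : Integrable (fun w : (ℝ × ℝ) × Z => (1 - Complex.I * z1 w.2) * (1 - Complex.I * z2 w.2) * Ψ w.2)
        ((nuE.prod nuE).prod μ) := hΨ.comp_snd _
    refine hi.bdd_mul (c := 1) hm.aestronglyMeasurable ?_
    filter_upwards with w
    rw [norm_mul, norm_chr, norm_chr, one_mul]

lemma ph_shift (p : ℝ × ℝ × ℝ) (ξ : ℝ × ℝ) (x y : ℝ) :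
    ph (p.1, p.2.1 + x, p.2.2 + y) ξ = ph p ξ * (chr (ξ.1 * x) * chr (ξ.2 * y)) := by
  unfold ph chr
  rw [← Complex.exp_add, ← Complex.exp_add]
  congr 1
  push_cast
  ring

/-- multiplier -/
noncomputable def cA (α : ℝ) : ℂ := 1 - Complex.I * α
noncomputable def cB (α : ℝ) : ℂ := - Complex.I * α

lemma norm_cA {α : ℝ} (h0 : 0 ≤ α) (h1 : α ≤ 1) : ‖cA α‖ ≤ 2 := by
  unfold cA
  refine (norm_sub_le _ _).trans ?_
  rw [norm_one, norm_mul, Complex.norm_I, one_mul, Complex.norm_real, Real.norm_of_nonneg h0]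
  linarith
lemma norm_cB {α : ℝ} (h0 : 0 ≤ α) (h1 : α ≤ 1) : ‖cB α‖ ≤ 2 := by
  unfold cB
  rw [norm_mul, norm_neg, Complex.norm_I, one_mul, Complex.norm_real, Real.norm_of_nonneg h0]
  linarith

lemma measurable_cA : Measurable cA := by unfold cA; fun_prop
lemma measurable_cB : Measurable cB := by unfold cB; fun_prop

/-- The four-term modified product. -/
noncomputable def fourT (F₁ F₂ F₃ F₄ G₁ G₂ G₃ G₄ : ℝ × ℝ → ℂ) (p : ℝ × ℝ × ℝ) : ℂ :=
  extOp F₁ p * extOp G₁ p + extOp F₂ p * extOp G₂ p + extOp F₃ p * extOp G₃ p + extOp F₄ p * extOp G₄ p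

lemma extOp_mul (F G : ℝ × ℝ → ℂ) (p : ℝ × ℝ × ℝ) :
    extOp F p * extOp G p = ∫ z : (ℝ × ℝ) × (ℝ × ℝ), (ph p z.1 * ph p z.2) * (F z.1 * G z.2) := by
  rw [extOp_eq, extOp_eq, ← integral_prod_mul]
  congr 1; ext z; ring

lemma integrable_pp {F G : ℝ × ℝ → ℂ} (hF : Integrable F) (hG : Integrable G) (p : ℝ × ℝ × ℝ) :
    Integrable (fun z : (ℝ × ℝ) × (ℝ × ℝ) => (ph p z.1 * ph p z.2) * (F z.1 * G z.2)) := by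
  have := (integrable_ph hF p).mul_prod (integrable_ph hG p)
  refine this.congr ?_
  filter_upwards with z; ring

lemma repro_pair {a b : ℝ} (ha : 0 < a) (hb : 0 < b) (k j d₁ d₂ : ℤ) (F G : ℝ × ℝ → ℂ)
    (F₁ F₂ F₃ G₂ G₃ G₄ : ℝ × ℝ → ℂ)
    (e1 : F₁ = fun ξ => cA (ξ.1 / a - k) * cA (ξ.2 / b - j) * F ξ)
    (e2 : F₂ = fun ξ => cA (ξ.1 / a - k) * F ξ)
    (e3 : F₃ = fun ξ => cA (ξ.2 / b - j) * F ξ)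
    (e4 : G₂ = fun ξ => cB (ξ.2 / b - (j + d₂)) * G ξ)
    (e5 : G₃ = fun ξ => cB (ξ.1 / a - (k + d₁)) * G ξ)
    (e6 : G₄ = fun ξ => cB (ξ.1 / a - (k + d₁)) * cB (ξ.2 / b - (j + d₂)) * G ξ)
    (hF : Integrable F) (hF₁ : Integrable F₁) (hF₂ : Integrable F₂) (hF₃ : Integrable F₃)
    (hG : Integrable G) (hG₂ : Integrable G₂) (hG₃ : Integrable G₃) (hG₄ : Integrable G₄)
    (p : ℝ × ℝ × ℝ) :
    extOp F p * extOp G p = ∫ u : ℝ × ℝ, chr (-(2 * k + d₁) * u.1) * chr (-(2 * j + d₂) * u.2) *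
      fourT F₁ F₂ F₃ F G G₂ G₃ G₄ (p.1, p.2.1 + a⁻¹ * u.1, p.2.2 + b⁻¹ * u.2) ∂(nuE.prod nuE) := by
  set z1 : (ℝ × ℝ) × (ℝ × ℝ) → ℝ := fun z => (z.1.1 + z.2.1) / a - (2 * k + d₁) with hz1
  set z2 : (ℝ × ℝ) × (ℝ × ℝ) → ℝ := fun z => (z.1.2 + z.2.2) / b - (2 * j + d₂) with hz2
  have hsum : ∀ (q : ℝ × ℝ × ℝ), fourT F₁ F₂ F₃ F G G₂ G₃ G₄ q = ∫ z : (ℝ × ℝ) × (ℝ × ℝ),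
      (ph q z.1 * ph q z.2) * ((1 - Complex.I * z1 z) * (1 - Complex.I * z2 z) * (F z.1 * G z.2)) ∧
      Integrable (fun z : (ℝ × ℝ) × (ℝ × ℝ) =>
      (ph q z.1 * ph q z.2) * ((1 - Complex.I * z1 z) * (1 - Complex.I * z2 z) * (F z.1 * G z.2))) := by
    intro q
    have i1 := integrable_pp hF₁ hG q
    have i2 := integrable_pp hF₂ hG₂ q
    have i3 := integrable_pp hF₃ hG₃ q
    have i4 := integrable_pp hF hG₄ q
    have e : (fun z : (ℝ × ℝ) × (ℝ × ℝ) =>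
      (ph q z.1 * ph q z.2) * ((1 - Complex.I * z1 z) * (1 - Complex.I * z2 z) * (F z.1 * G z.2))) =
      fun z => (((ph q z.1 * ph q z.2) * (F₁ z.1 * G z.2) + (ph q z.1 * ph q z.2) * (F₂ z.1 * G₂ z.2)) +
        (ph q z.1 * ph q z.2) * (F₃ z.1 * G₃ z.2)) + (ph q z.1 * ph q z.2) * (F z.1 * G₄ z.2) := by
      ext z
      simp only [e1, e2, e3, e4, e5, e6, hz1, hz2, cA, cB]
      push_cast
      ring
    constructor
    · unfold fourT
      rw [e, integral_add, integral_add, integral_add i1 i2, extOp_mul, extOp_mul, extOp_mul, extOp_mul]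
      · exact i1.add i2
      · exact i3
      · exact (i1.add i2).add i3
      · exact i4
    · rw [e]
      exact ((i1.add i2).add i3).add i4
  rw [extOp_mul, repro volume z1 z2 (by rw [hz1]; fun_prop) (by rw [hz2]; fun_prop)]
  · congr 1; ext u
    rw [(hsum _).1, ← integral_const_mul]
    congr 1; ext z
    rw [ph_shift, ph_shift]
    have c1 : chr (z1 z * u.1) = chr (-(2 * k + d₁) * u.1) * chr (z.1.1 * (a⁻¹ * u.1)) * chr (z.2.1 * (a⁻¹ * u.1)) := by
      rw [← chr_add, ← chr_add]; congr 1; simp only [hz1]; ring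
    have c2 : chr (z2 z * u.2) = chr (-(2 * j + d₂) * u.2) * chr (z.1.2 * (b⁻¹ * u.2)) * chr (z.2.2 * (b⁻¹ * u.2)) := by
      rw [← chr_add, ← chr_add]; congr 1; simp only [hz2]; ring
    rw [c1, c2]
    ring
  · refine (hsum p).2.congr ?_
    filter_upwards with z; ring


lemma integrable_of_rect {f : ℝ × ℝ → ℂ} (hf : Measurable f) {M a b u v : ℝ} (hM : ∀ ξ, ‖f ξ‖ ≤ M)
    (hs : ∀ ξ, f ξ ≠ 0 → ξ ∈ rect a b u v) : Integrable f := by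
  rw [← integrableOn_iff_integrable_of_support_subset (s := rect a b u v) (fun ξ h => hs ξ h)]
  have hfin : volume (rect a b u v) ≠ ⊤ := ((isCompact_Icc).prod isCompact_Icc).measure_lt_top.ne
  refine Measure.integrableOn_of_bounded (M := M) hfin hf.aestronglyMeasurable ?_
  filter_upwards with ξ using hM ξ

lemma norm_extOp_le {f : ℝ × ℝ → ℂ} (p : ℝ × ℝ × ℝ) : ‖extOp f p‖ ≤ ∫ ξ, ‖f ξ‖ := by
  rw [extOp_eq]
  refine (norm_integral_le_integral_norm _).trans (le_of_eq ?_)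
  congr 1; ext ξ; rw [norm_mul, norm_ph, one_mul]

lemma eLpNorm_ofReal_eq {s : ℝ} (hs : 0 < s) {X : Type*} [MeasurableSpace X] (μ : Measure X) (f : X → ℂ) :
    eLpNorm f (ENNReal.ofReal s) μ = (∫⁻ x, ‖f x‖ₑ ^ s ∂μ) ^ (1 / s) := by
  rw [eLpNorm_eq_lintegral_rpow_enorm_toReal (by simpa using hs) ENNReal.ofReal_ne_top,
    ENNReal.toReal_ofReal hs.le]

lemma lintegral_eq_eLpNorm {s : ℝ} (hs : 0 < s) {X : Type*} [MeasurableSpace X] (μ : Measure X) (f : X → ℂ) :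
    (∫⁻ x, ‖f x‖ₑ ^ s ∂μ) = eLpNorm f (ENNReal.ofReal s) μ ^ s := by
  rw [eLpNorm_ofReal_eq hs, ← ENNReal.rpow_mul, one_div_mul_cancel hs.ne', ENNReal.rpow_one]

lemma rect_coord {a b : ℝ} (ha : 0 < a) (hb : 0 < b) {k j : ℝ} {ξ : ℝ × ℝ}
    (h : ξ ∈ rect a b (k * a) (j * b)) :
    0 ≤ ξ.1 / a - k ∧ ξ.1 / a - k ≤ 1 ∧ 0 ≤ ξ.2 / b - j ∧ ξ.2 / b - j ≤ 1 := by
  obtain ⟨⟨h1, h2⟩, h3, h4⟩ := h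
  have e1 : ξ.1 / a * a = ξ.1 := div_mul_cancel₀ _ ha.ne'
  have e2 : ξ.2 / b * b = ξ.2 := div_mul_cancel₀ _ hb.ne'
  refine ⟨?_, ?_, ?_, ?_⟩ <;> nlinarith

lemma block {s r A : ℝ} (hs : 1 < s) (hs2 : s ≤ 2) (hr : 0 < r) (hA : 0 ≤ A) (h : BH s r A)
    {a b : ℝ} (ha : 0 < a) (hb : 0 < b) (d₁ d₂ : ℤ) (h1 : 2 ≤ |d₁|) (h2 : |d₁| ≤ 5) (h3 : 2 ≤ |d₂|)
    (h4 : |d₂| ≤ 5) (T₁ T₂ : Finset ℤ) (F G : ℤ → ℤ → ℝ × ℝ → ℂ)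
    (hFm : ∀ k j, Measurable (F k j)) (hGm : ∀ k j, Measurable (G k j))
    (hFb : ∀ k j ξ, ‖F k j ξ‖ ≤ 1) (hGb : ∀ k j ξ, ‖G k j ξ‖ ≤ 1)
    (E E' : ℤ → ℤ → Set (ℝ × ℝ)) (hE : ∀ k j, MeasurableSet (E k j)) (hE' : ∀ k j, MeasurableSet (E' k j))
    {e e' : ℝ} (he0 : 0 ≤ e) (he0' : 0 ≤ e')
    (he : ∀ k j, volume (E k j) ≤ ENNReal.ofReal e) (he' : ∀ k j, volume (E' k j) ≤ ENNReal.ofReal e')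
    (hFE : ∀ k j ξ, F k j ξ ≠ 0 → ξ ∈ E k j) (hGE : ∀ k j ξ, G k j ξ ≠ 0 → ξ ∈ E' k j)
    (hFR : ∀ k j ξ, F k j ξ ≠ 0 → ξ ∈ rect a b (k * a) (j * b))
    (hGR : ∀ k j ξ, G k j ξ ≠ 0 → ξ ∈ rect a b ((k + d₁) * a) ((j + d₂) * b)) :
    eLpNorm (fun p => ∑ k ∈ T₁, ∑ j ∈ T₂, extOp (F k j) p * extOp (G k j) p) (ENNReal.ofReal s) volume ≤
      ENNReal.ofReal (Wc * (64 * A) * ((T₁.card * T₂.card : ℝ) ^ (1 / s) *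
        ((a * b) ^ (2 * (1 - 1 / s) - 2 / r) * (e * e') ^ (1 / r)))) := by
  have hs0 : 0 < s := by linarith
  set F₁ : ℤ → ℤ → ℝ × ℝ → ℂ := fun k j ξ => cA (ξ.1 / a - k) * cA (ξ.2 / b - j) * F k j ξ with e1
  set F₂ : ℤ → ℤ → ℝ × ℝ → ℂ := fun k j ξ => cA (ξ.1 / a - k) * F k j ξ with e2
  set F₃ : ℤ → ℤ → ℝ × ℝ → ℂ := fun k j ξ => cA (ξ.2 / b - j) * F k j ξ with e3
  set G₂ : ℤ → ℤ → ℝ × ℝ → ℂ := fun k j ξ => cB (ξ.2 / b - (j + d₂)) * G k j ξ with e4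
  set G₃ : ℤ → ℤ → ℝ × ℝ → ℂ := fun k j ξ => cB (ξ.1 / a - (k + d₁)) * G k j ξ with e5
  set G₄ : ℤ → ℤ → ℝ × ℝ → ℂ := fun k j ξ => cB (ξ.1 / a - (k + d₁)) * cB (ξ.2 / b - (j + d₂)) * G k j ξ with e6
  -- general facts
  have key : ∀ (f : ℝ × ℝ → ℂ) (u v : ℝ) (c : ℝ × ℝ → ℂ), Measurable c → Measurable f →
      (∀ ξ, ‖f ξ‖ ≤ 1) → (∀ ξ, f ξ ≠ 0 → ξ ∈ rect a b u v) → (∀ ξ ∈ rect a b u v, ‖c ξ‖ ≤ 4) →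
      (∀ ξ, ‖c ξ * f ξ‖ ≤ 4) ∧ (∀ ξ, c ξ * f ξ ≠ 0 → f ξ ≠ 0) ∧ Integrable (fun ξ => c ξ * f ξ) := by
    intro f u v c hc hf hb hsu hcb
    have p1 : ∀ ξ, ‖c ξ * f ξ‖ ≤ 4 := by
      intro ξ
      rw [norm_mul]
      by_cases h0 : f ξ = 0
      · simp [h0]
      · have := hcb ξ (hsu ξ h0)
        nlinarith [hb ξ, norm_nonneg (f ξ), norm_nonneg (c ξ)]
    have p2 : ∀ ξ, c ξ * f ξ ≠ 0 → f ξ ≠ 0 := fun ξ h => right_ne_zero_of_mul h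
    exact ⟨p1, p2, integrable_of_rect (hc.mul hf) p1 (fun ξ h => hsu ξ (p2 ξ h))⟩
  have hmA := measurable_cA
  have hmB := measurable_cB
  have one4 : ∀ x y : ℂ, ‖x‖ ≤ 2 → ‖y‖ ≤ 2 → ‖x * y‖ ≤ 4 := by
    intro x y hx hy
    rw [norm_mul]; nlinarith [norm_nonneg x, norm_nonneg y]
  have kF₁ := fun k j => key (F k j) _ _ (fun ξ => cA (ξ.1 / a - k) * cA (ξ.2 / b - j)) (by fun_prop) (hFm k j) (hFb k j) (hFR k j)
    (fun ξ hξ => by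
      obtain ⟨q1, q2, q3, q4⟩ := rect_coord ha hb hξ
      exact one4 _ _ (norm_cA q1 q2) (norm_cA q3 q4))
  have kF₂ := fun k j => key (F k j) _ _ (fun ξ => cA (ξ.1 / a - k)) (by fun_prop) (hFm k j) (hFb k j) (hFR k j)
    (fun ξ hξ => by
      obtain ⟨q1, q2, q3, q4⟩ := rect_coord ha hb hξ
      exact (norm_cA q1 q2).trans (by norm_num))
  have kF₃ := fun k j => key (F k j) _ _ (fun ξ => cA (ξ.2 / b - j)) (by fun_prop) (hFm k j) (hFb k j) (hFR k j)
    (fun ξ hξ => by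
      obtain ⟨q1, q2, q3, q4⟩ := rect_coord ha hb hξ
      exact (norm_cA q3 q4).trans (by norm_num))
  have kG₂ := fun k j => key (G k j) _ _ (fun ξ => cB (ξ.2 / b - (j + d₂))) (by fun_prop) (hGm k j) (hGb k j) (hGR k j)
    (fun ξ hξ => by
      obtain ⟨q1, q2, q3, q4⟩ := rect_coord ha hb hξ
      exact (norm_cB q3 q4).trans (by norm_num))
  have kG₃ := fun k j => key (G k j) _ _ (fun ξ => cB (ξ.1 / a - (k + d₁))) (by fun_prop) (hGm k j) (hGb k j) (hGR k j)
    (fun ξ hξ => by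
      obtain ⟨q1, q2, q3, q4⟩ := rect_coord ha hb hξ
      exact (norm_cB q1 q2).trans (by norm_num))
  have kG₄ := fun k j => key (G k j) _ _ (fun ξ => cB (ξ.1 / a - (k + d₁)) * cB (ξ.2 / b - (j + d₂))) (by fun_prop) (hGm k j) (hGb k j) (hGR k j)
    (fun ξ hξ => by
      obtain ⟨q1, q2, q3, q4⟩ := rect_coord ha hb hξ
      exact one4 _ _ (norm_cB q1 q2) (norm_cB q3 q4))
  have iF := fun k j => integrable_of_rect (hFm k j) (hFb k j) (hFR k j)
  have iG := fun k j => integrable_of_rect (hGm k j) (hGb k j) (hGR k j)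
  set GG : ℤ → ℤ → ℝ × ℝ × ℝ → ℂ := fun k j =>
    fourT (F₁ k j) (F₂ k j) (F₃ k j) (F k j) (G k j) (G₂ k j) (G₃ k j) (G₄ k j) with hGG
  have hcont : ∀ k j, Continuous (GG k j) := by
    intro k j
    simp only [hGG]
    unfold fourT
    exact ((((continuous_extOp (kF₁ k j).2.2).mul (continuous_extOp (iG k j))).add
      ((continuous_extOp (kF₂ k j).2.2).mul (continuous_extOp (kG₂ k j).2.2))).add
      ((continuous_extOp (kF₃ k j).2.2).mul (continuous_extOp (kG₃ k j).2.2))).add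
      ((continuous_extOp (iF k j)).mul (continuous_extOp (kG₄ k j).2.2))
  have hbdd : ∀ k j, ∃ B, ∀ p, ‖GG k j p‖ ≤ B := by
    intro k j
    have bm : ∀ (f g : ℝ × ℝ → ℂ) p, ‖extOp f p * extOp g p‖ ≤ (∫ ξ, ‖f ξ‖) * ∫ ξ, ‖g ξ‖ := by
      intro f g p
      rw [norm_mul]
      exact mul_le_mul (norm_extOp_le p) (norm_extOp_le p) (norm_nonneg _) (integral_nonneg fun _ => norm_nonneg _)
    refine ⟨_, fun p => (norm_add_le _ _).trans (add_le_add ((norm_add_le _ _).trans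
      (add_le_add ((norm_add_le _ _).trans (add_le_add (bm _ _ p) (bm _ _ p))) (bm _ _ p))) (bm _ _ p))⟩
  have hort := ortho hs.le hs2 T₁ T₂ d₁ d₂ a⁻¹ b⁻¹ GG hcont hbdd
    (fun p => ∑ k ∈ T₁, ∑ j ∈ T₂, extOp (F k j) p * extOp (G k j) p) (by
      intro p
      refine Finset.sum_congr rfl fun k _ => Finset.sum_congr rfl fun j _ => ?_
      exact repro_pair ha hb k j d₁ d₂ (F k j) (G k j) _ _ _ _ _ _ rfl rfl rfl rfl rfl rfl (iF k j) (kF₁ k j).2.2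
        (kF₂ k j).2.2 (kF₃ k j).2.2 (iG k j) (kG₂ k j).2.2 (kG₃ k j).2.2 (kG₄ k j).2.2 p)
  set X : ℝ := (a * b) ^ (2 * (1 - 1 / s) - 2 / r) * (e * e') ^ (1 / r) with hX
  have hX0 : 0 ≤ X := by positivity
  have sep : ∀ (k d : ℤ) (c : ℝ), 0 < c → 2 ≤ |d| → |d| ≤ 5 → 2 * c ≤ |(k : ℝ) * c - (k + d) * c| ∧
      |(k : ℝ) * c - (k + d) * c| ≤ 5 * c := by
    intro k d c hc hd1 hd2
    have e : (k : ℝ) * c - (k + d) * c = - (d * c) := by ring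
    have hd1' : (2 : ℝ) ≤ |(d : ℝ)| := by exact_mod_cast hd1
    have hd2' : |(d : ℝ)| ≤ 5 := by exact_mod_cast hd2
    rw [e, abs_neg, abs_mul, abs_of_pos hc]
    constructor <;> nlinarith
  have term : ∀ k j (f g : ℝ × ℝ → ℂ), (∀ ξ, ‖f ξ‖ ≤ 4) → (∀ ξ, ‖g ξ‖ ≤ 4) → (∀ ξ, f ξ ≠ 0 → F k j ξ ≠ 0) →
      (∀ ξ, g ξ ≠ 0 → G k j ξ ≠ 0) →
      eLpNorm (fun p => extOp f p * extOp g p) (ENNReal.ofReal s) volume ≤ ENNReal.ofReal (A * 4 ^ 2 * X) := by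
    intro k j f g hf hg hfF hgG
    exact scaledBH hs hr hA h ha hb (sep k d₁ a ha h1 h2).1 (sep k d₁ a ha h1 h2).2 (sep j d₂ b hb h3 h4).1
      (sep j d₂ b hb h3 h4).2 (by norm_num) (hE k j) (hE' k j) (he k j) (he' k j) he0 he0' hf hg
      (fun ξ h => hFE k j ξ (hfF ξ h)) (fun ξ h => hGE k j ξ (hgG ξ h))
      (fun ξ h => hFR k j ξ (hfF ξ h)) (fun ξ h => hGR k j ξ (hgG ξ h))
  have hGGn : ∀ k j, eLpNorm (GG k j) (ENNReal.ofReal s) volume ≤ ENNReal.ofReal (64 * A * X) := by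
    intro k j
    have hF4 : ∀ ξ, ‖F k j ξ‖ ≤ 4 := fun ξ => (hFb k j ξ).trans (by norm_num)
    have hG4 : ∀ ξ, ‖G k j ξ‖ ≤ 4 := fun ξ => (hGb k j ξ).trans (by norm_num)
    have t1 := term k j (F₁ k j) (G k j) (kF₁ k j).1 hG4 (kF₁ k j).2.1 (fun _ h => h)
    have t2 := term k j (F₂ k j) (G₂ k j) (kF₂ k j).1 (kG₂ k j).1 (kF₂ k j).2.1 (kG₂ k j).2.1
    have t3 := term k j (F₃ k j) (G₃ k j) (kF₃ k j).1 (kG₃ k j).1 (kF₃ k j).2.1 (kG₃ k j).2.1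
    have t4 := term k j (F k j) (G₄ k j) hF4 (kG₄ k j).1 (fun _ h => h) (kG₄ k j).2.1
    have c1 := ((continuous_extOp (kF₁ k j).2.2).mul (continuous_extOp (iG k j)))
    have c2 := ((continuous_extOp (kF₂ k j).2.2).mul (continuous_extOp (kG₂ k j).2.2))
    have c3 := ((continuous_extOp (kF₃ k j).2.2).mul (continuous_extOp (kG₃ k j).2.2))
    have c4 := ((continuous_extOp (iF k j)).mul (continuous_extOp (kG₄ k j).2.2))
    have h1s : 1 ≤ ENNReal.ofReal s := by rw [ENNReal.one_le_ofReal]; exact hs.le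
    have q := eLpNorm_add_le (μ := volume) ((c1.add c2).add c3).aestronglyMeasurable c4.aestronglyMeasurable h1s
    have q2 := eLpNorm_add_le (μ := volume) (c1.add c2).aestronglyMeasurable c3.aestronglyMeasurable h1s
    have q3 := eLpNorm_add_le (μ := volume) c1.aestronglyMeasurable c2.aestronglyMeasurable h1s
    refine q.trans ((add_le_add (q2.trans (add_le_add (q3.trans (add_le_add t1 t2)) t3)) t4).trans (le_of_eq ?_))
    rw [← ENNReal.ofReal_add, ← ENNReal.ofReal_add, ← ENNReal.ofReal_add]
    · congr 1; ring
    all_goals positivity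
  have hW := Wc_nonneg
  rw [eLpNorm_ofReal_eq hs0]
  have hstep : ∫⁻ p, ‖∑ k ∈ T₁, ∑ j ∈ T₂, extOp (F k j) p * extOp (G k j) p‖ₑ ^ s ≤
      ENNReal.ofReal (Wc ^ s * (T₁.card * T₂.card * (64 * A * X) ^ s)) := by
    refine hort.trans ?_
    rw [ENNReal.ofReal_mul (by positivity), ← ENNReal.ofReal_rpow_of_nonneg hW hs0.le]
    refine mul_le_mul' le_rfl ?_
    calc _ ≤ ∑ k ∈ T₁, ∑ j ∈ T₂, ENNReal.ofReal ((64 * A * X) ^ s) := by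
          refine Finset.sum_le_sum fun k _ => Finset.sum_le_sum fun j _ => ?_
          rw [lintegral_eq_eLpNorm hs0, ← ENNReal.ofReal_rpow_of_nonneg (by positivity) hs0.le]
          exact ENNReal.rpow_le_rpow (hGGn k j) hs0.le
      _ = _ := by
          rw [ENNReal.ofReal_mul (by positivity), ENNReal.ofReal_mul (by positivity)]
          simp [mul_assoc]
  refine (ENNReal.rpow_le_rpow hstep (by positivity)).trans (le_of_eq ?_)
  rw [ENNReal.ofReal_rpow_of_nonneg (by positivity) (by positivity)]
  congr 1
  rw [Real.mul_rpow (by positivity) (by positivity), Real.mul_rpow (by positivity) (by positivity),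
    ← Real.rpow_mul hW, ← Real.rpow_mul (by positivity), mul_one_div_cancel hs0.ne', Real.rpow_one, Real.rpow_one]
  ring


noncomputable def kf (m : ℤ) (x : ℝ) : ℤ := ⌊(2 : ℝ) ^ m * x⌋

def relW (k k' : ℤ) : Prop := 2 ≤ |k - k'| ∧ |k / 2 - k' / 2| ≤ 1

lemma kf_pred (m : ℤ) (x : ℝ) : kf (m - 1) x = kf m x / 2 := by
  unfold kf
  rw [zpow_sub_one₀ (by norm_num : (2 : ℝ) ≠ 0)]
  set y := (2 : ℝ) ^ m * x with hy
  have e : (2 : ℝ) ^ m * 2⁻¹ * x = y / 2 := by rw [hy]; ring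
  rw [e, Int.floor_eq_iff]
  have h1 := Int.floor_le y
  have h2 := Int.lt_floor_add_one y
  have h3 : 2 * (⌊y⌋ / 2) ≤ ⌊y⌋ := by omega
  have h4 : ⌊y⌋ + 1 ≤ 2 * (⌊y⌋ / 2) + 2 := by omega
  have h3' : (2 : ℝ) * ((⌊y⌋ / 2 : ℤ) : ℝ) ≤ (⌊y⌋ : ℝ) := by exact_mod_cast h3
  have h4' : (⌊y⌋ : ℝ) + 1 ≤ (2 : ℝ) * ((⌊y⌋ / 2 : ℤ) : ℝ) + 2 := by exact_mod_cast h4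
  constructor <;> linarith

lemma relW_iff (m : ℤ) (x y : ℝ) : relW (kf m x) (kf m y) ↔
    ¬ (|kf m x - kf m y| ≤ 1) ∧ |kf (m - 1) x - kf (m - 1) y| ≤ 1 := by
  rw [kf_pred, kf_pred]; unfold relW
  constructor
  · rintro ⟨h1, h2⟩; exact ⟨by omega, h2⟩
  · rintro ⟨h1, h2⟩; exact ⟨by omega, h2⟩

lemma near_mono_aux (x y : ℝ) (m : ℤ) (h : |kf m x - kf m y| ≤ 1) : |kf (m - 1) x - kf (m - 1) y| ≤ 1 := by
  rw [kf_pred, kf_pred]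
  rw [abs_le] at *
  omega

lemma near_mono (x y : ℝ) (m m' : ℤ) (hm : m' ≤ m) (h : |kf m x - kf m y| ≤ 1) :
    |kf m' x - kf m' y| ≤ 1 := by
  obtain ⟨n, rfl⟩ : ∃ n : ℕ, m' = m - n := ⟨(m - m').toNat, by omega⟩
  clear hm
  induction n with
  | zero => simpa using h
  | succ n ih =>
    have := near_mono_aux x y _ ih
    rw [Nat.cast_succ, ← sub_sub]
    exact this

lemma exists_pow_big (z : ℝ) (hz : 0 < z) (B : ℝ) : ∃ m : ℤ, B ≤ (2 : ℝ) ^ m * z := by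
  obtain ⟨n, hn⟩ := pow_unbounded_of_one_lt (B / z) (by norm_num : (1 : ℝ) < 2)
  refine ⟨n, ?_⟩
  rw [zpow_natCast]
  rw [div_lt_iff₀ hz] at hn
  exact hn.le

lemma exists_pow_small (z : ℝ) (hz : 0 ≤ z) : ∃ m : ℤ, (2 : ℝ) ^ m * z < 1 := by
  obtain ⟨n, hn⟩ := pow_unbounded_of_one_lt z (by norm_num : (1 : ℝ) < 2)
  refine ⟨-n, ?_⟩
  rw [zpow_neg, zpow_natCast, inv_mul_lt_iff₀ (by positivity)]
  linarith

lemma exists_relW (x y : ℝ) (h : x ≠ y) : ∃ m, relW (kf m x) (kf m y) := by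
  obtain ⟨M, hM⟩ := exists_pow_big |x - y| (abs_pos.2 (sub_ne_zero.2 h)) 3
  obtain ⟨m₀, hm₀⟩ := exists_pow_small (|x| + |y|) (by positivity)
  have hfar : ¬ (|kf M x - kf M y| ≤ 1) := by
    intro hc
    have a1 := Int.floor_le ((2 : ℝ) ^ M * x)
    have a2 := Int.lt_floor_add_one ((2 : ℝ) ^ M * x)
    have a3 := Int.floor_le ((2 : ℝ) ^ M * y)
    have a4 := Int.lt_floor_add_one ((2 : ℝ) ^ M * y)
    have hc' : |(kf M x : ℝ) - kf M y| ≤ 1 := by exact_mod_cast hc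
    unfold kf at hc'
    have : |(2 : ℝ) ^ M * x - (2 : ℝ) ^ M * y| = (2 : ℝ) ^ M * |x - y| := by
      rw [← mul_sub, abs_mul, abs_of_pos (by positivity)]
    rw [← this] at hM
    rw [abs_le] at hc'
    have : |(2 : ℝ) ^ M * x - (2 : ℝ) ^ M * y| < 3 := by
      rw [abs_lt]; constructor <;> linarith
    linarith
  have hnear : |kf m₀ x - kf m₀ y| ≤ 1 := by
    have hb : ∀ z : ℝ, |z| ≤ |x| + |y| → -1 ≤ kf m₀ z ∧ kf m₀ z ≤ 0 := by
      intro z hz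
      have hp : (0 : ℝ) < (2 : ℝ) ^ m₀ := by positivity
      have : |(2 : ℝ) ^ m₀ * z| < 1 := by
        rw [abs_mul, abs_of_pos hp]
        exact lt_of_le_of_lt (by gcongr) hm₀
      rw [abs_lt] at this
      unfold kf
      constructor
      · rw [Int.le_floor]; push_cast; linarith
      · rw [← Int.lt_add_one_iff, Int.floor_lt]; push_cast; linarith
    have h1 := hb x (by linarith [abs_nonneg y])
    have h2 := hb y (by linarith [abs_nonneg x])
    rw [abs_le]; omega
  obtain ⟨m, hm, hmax⟩ := Int.exists_greatest_of_bdd (P := fun m => |kf m x - kf m y| ≤ 1)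
    ⟨M, fun z hz => by
      by_contra hlt
      exact hfar (near_mono x y z M (by omega) hz)⟩ ⟨m₀, hnear⟩
  refine ⟨m + 1, (relW_iff _ _ _).2 ⟨fun hc => ?_, by simpa using hm⟩⟩
  have := hmax _ hc
  omega

lemma relW_unique (x y : ℝ) (m m' : ℤ) (h : relW (kf m x) (kf m y)) (h' : relW (kf m' x) (kf m' y)) :
    m = m' := by
  rw [relW_iff] at h h'
  by_contra hne
  rcases lt_or_gt_of_ne hne with hl | hl
  · exact h.1 (near_mono x y (m' - 1) m (by omega) h'.2)
  · exact h'.1 (near_mono x y (m - 1) m' (by omega) h.2)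

lemma measurable_kf (m : ℤ) : Measurable (kf m) := by
  unfold kf; exact Int.measurable_floor.comp (measurable_const.mul measurable_id)

def WS (i : ℤ × ℤ) : Set ((ℝ × ℝ) × (ℝ × ℝ)) :=
  {z | relW (kf i.1 z.1.1) (kf i.1 z.2.1) ∧ relW (kf i.2 z.1.2) (kf i.2 z.2.2)}

lemma measurableSet_WS (i : ℤ × ℤ) : MeasurableSet (WS i) := by
  have h1 : Measurable (fun z : (ℝ × ℝ) × (ℝ × ℝ) => (kf i.1 z.1.1, kf i.1 z.2.1)) :=
    ((measurable_kf _).comp (measurable_fst.comp measurable_fst)).prodMk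
      ((measurable_kf _).comp (measurable_fst.comp measurable_snd))
  have h2 : Measurable (fun z : (ℝ × ℝ) × (ℝ × ℝ) => (kf i.2 z.1.2, kf i.2 z.2.2)) :=
    ((measurable_kf _).comp (measurable_snd.comp measurable_fst)).prodMk
      ((measurable_kf _).comp (measurable_snd.comp measurable_snd))
  have hs : MeasurableSet {q : ℤ × ℤ | relW q.1 q.2} := (Set.to_countable _).measurableSet
  exact (h1 hs).inter (h2 hs)

lemma disjoint_WS : Pairwise (Function.onFun Disjoint WS) := by
  intro i i' hne
  rw [Function.onFun, Set.disjoint_left]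
  rintro z ⟨h1, h2⟩ ⟨h3, h4⟩
  exact hne (Prod.ext (relW_unique _ _ _ _ h1 h3) (relW_unique _ _ _ _ h2 h4))

lemma ae_mem_WS : ∀ᵐ z : (ℝ × ℝ) × (ℝ × ℝ), z ∈ ⋃ i, WS i := by
  have hn : ∀ᵐ z : (ℝ × ℝ) × (ℝ × ℝ), z.1.1 ≠ z.2.1 ∧ z.1.2 ≠ z.2.2 := by
    have : ∀ x : ℝ × ℝ, ∀ᵐ y : ℝ × ℝ, x.1 ≠ y.1 ∧ x.2 ≠ y.2 := by
      intro x
      have a1 : ∀ᵐ y : ℝ × ℝ, x.1 ≠ y.1 := by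
        have := (Measure.quasiMeasurePreserving_fst (μ := (volume : Measure ℝ)) (ν := (volume : Measure ℝ))).ae
          (p := fun t => x.1 ≠ t) (by
            rw [ae_iff]; simp)
        exact this
      have a2 : ∀ᵐ y : ℝ × ℝ, x.2 ≠ y.2 := by
        have := (Measure.quasiMeasurePreserving_snd (μ := (volume : Measure ℝ)) (ν := (volume : Measure ℝ))).ae
          (p := fun t => x.2 ≠ t) (by
            rw [ae_iff]; simp)
        exact this
      filter_upwards [a1, a2] with y h1 h2 using ⟨h1, h2⟩
    have hms : MeasurableSet {z : (ℝ × ℝ) × (ℝ × ℝ) | z.1.1 ≠ z.2.1 ∧ z.1.2 ≠ z.2.2} := by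
      have m1 : MeasurableSet {z : (ℝ × ℝ) × (ℝ × ℝ) | z.1.1 = z.2.1} :=
        measurableSet_eq_fun (by fun_prop) (by fun_prop)
      have m2 : MeasurableSet {z : (ℝ × ℝ) × (ℝ × ℝ) | z.1.2 = z.2.2} :=
        measurableSet_eq_fun (by fun_prop) (by fun_prop)
      exact m1.compl.inter m2.compl
    exact (Measure.ae_prod_iff_ae_ae (μ := (volume : Measure (ℝ × ℝ))) (ν := (volume : Measure (ℝ × ℝ))) hms).2
      (Filter.Eventually.of_forall this)
  filter_upwards [hn] with z hz
  obtain ⟨m, hm⟩ := exists_relW _ _ hz.1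
  obtain ⟨l, hl⟩ := exists_relW _ _ hz.2
  exact mem_iUnion.2 ⟨(m, l), hm, hl⟩

lemma hasSum_WS {Φ : (ℝ × ℝ) × (ℝ × ℝ) → ℂ} (hΦ : Integrable Φ) :
    HasSum (fun i => ∫ z in WS i, Φ z) (∫ z, Φ z) := by
  have := hasSum_integral_iUnion (μ := volume) (f := Φ) measurableSet_WS disjoint_WS hΦ.integrableOn
  rwa [setIntegral_eq_integral_of_ae_compl_eq_zero ?_] at this
  filter_upwards [ae_mem_WS] with z hz h
  exact absurd hz h

/-- Countable Minkowski -/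
lemma eLpNorm_hasSum_le {ι X : Type*} [Denumerable ι] [MeasurableSpace X] {μ : Measure X} {q : ℝ≥0∞} (hq : 1 ≤ q)
    (h : ι → X → ℂ) (hm : ∀ i, AEStronglyMeasurable (h i) μ) (H : X → ℂ) (hH : ∀ x, HasSum (fun i => h i x) (H x)) :
    eLpNorm H q μ ≤ ∑' i, eLpNorm (h i) q μ := by
  set e := (Denumerable.eqv ι).symm
  have hlim : ∀ x, Filter.Tendsto (fun n => ∑ i ∈ Finset.range n, h (e i) x) Filter.atTop (nhds (H x)) := by
    intro x
    exact ((e.hasSum_iff (f := fun i => h i x)).2 (hH x)).tendsto_sum_nat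
  have := Lp.eLpNorm_lim_le_liminf_eLpNorm (p := q) (μ := μ) (f := fun n x => ∑ i ∈ Finset.range n, h (e i) x)
    (fun n => by
      have := Finset.aestronglyMeasurable_sum (Finset.range n) (fun i _ => hm (e i))
      refine this.congr ?_
      filter_upwards with x; simp) H (Filter.Eventually.of_forall hlim)
  refine this.trans ?_
  refine Filter.liminf_le_of_le (by isBoundedDefault) ?_
  intro b hb
  obtain ⟨n, hn⟩ := hb.exists
  refine hn.trans ?_
  have e1 : (fun x => ∑ i ∈ Finset.range n, h (e i) x) = ∑ i ∈ Finset.range n, h (e i) := by ext; simp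
  rw [e1]
  refine (eLpNorm_sum_le (fun i _ => hm (e i)) hq).trans ?_
  refine (ENNReal.sum_le_tsum _).trans ?_
  exact (e.tsum_eq (fun i => eLpNorm (h i) q μ)).le


noncomputable def TT (m J M : ℤ) : Finset ℤ :=
  Finset.Icc ⌊(2 : ℝ) ^ (m - J) * M⌋ ⌊(2 : ℝ) ^ (m - J) * (M + 1)⌋

lemma mem_TT {m J M : ℤ} {x : ℝ} (h : x ∈ dyadicIcc J M) : kf m x ∈ TT m J M := by
  obtain ⟨h1, h2⟩ := h
  have hp : (0 : ℝ) < 2 ^ m := by positivity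
  have e : (2 : ℝ) ^ (m - J) = 2 ^ m * 2 ^ (-J) := by
    rw [← zpow_add₀ (by norm_num)]; congr 1
  unfold TT kf
  rw [Finset.mem_Icc, e]
  constructor
  · apply Int.floor_le_floor
    nlinarith
  · apply Int.floor_le_floor
    nlinarith

lemma card_TT (m J M : ℤ) : ((TT m J M).card : ℝ) ≤ 3 * max 1 ((2 : ℝ) ^ (m - J)) := by
  unfold TT
  set t := (2 : ℝ) ^ (m - J) with ht
  have ht0 : 0 < t := by positivity
  rw [Int.card_Icc]
  have h1 : ⌊t * M⌋ ≤ ⌊t * (M + 1)⌋ := Int.floor_le_floor (by nlinarith)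
  have e : (((⌊t * (M + 1)⌋ + 1 - ⌊t * M⌋).toNat : ℕ) : ℝ) = ((⌊t * (M + 1)⌋ + 1 - ⌊t * M⌋ : ℤ) : ℝ) := by
    have : (((⌊t * (M + 1)⌋ + 1 - ⌊t * M⌋).toNat : ℕ) : ℤ) = (⌊t * (M + 1)⌋ + 1 - ⌊t * M⌋ : ℤ) :=
      Int.toNat_of_nonneg (by omega)
    exact_mod_cast this
  rw [e]
  push_cast
  have a1 := Int.floor_le (t * (M + 1))
  have a2 := Int.lt_floor_add_one (t * M)
  have m1 := le_max_left 1 t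
  have m2 := le_max_right 1 t
  linarith

noncomputable def TD (m J M J' M' d : ℤ) : Finset ℤ := (TT m J M).filter (fun k => k + d ∈ TT m J' M')

lemma card_TD (m J M J' M' d : ℤ) : ((TD m J M J' M' d).card : ℝ) ≤
    3 * min (max 1 ((2 : ℝ) ^ (m - J))) (max 1 ((2 : ℝ) ^ (m - J'))) := by
  have h1 : (TD m J M J' M' d).card ≤ (TT m J M).card := Finset.card_filter_le _ _
  have h2 : (TD m J M J' M' d).card ≤ (TT m J' M').card := by
    refine Finset.card_le_card_of_injOn (fun k => k + d) ?_ ?_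
    · intro k hk
      exact (Finset.mem_filter.1 hk).2
    · intro x _ y _ h
      simpa using h
  have h1' : ((TD m J M J' M' d).card : ℝ) ≤ (TT m J M).card := by exact_mod_cast h1
  have h2' : ((TD m J M J' M' d).card : ℝ) ≤ (TT m J' M').card := by exact_mod_cast h2
  have h3 := card_TT m J M
  have h4 := card_TT m J' M'
  rcases min_choice (max 1 ((2 : ℝ) ^ (m - J))) (max 1 ((2 : ℝ) ^ (m - J'))) with h | h <;> rw [h] <;> linarith

def DD : Finset ℤ := {-3, -2, 2, 3}

lemma mem_DD_iff {d : ℤ} : d ∈ DD ↔ d = -3 ∨ d = -2 ∨ d = 2 ∨ d = 3 := by simp [DD]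

lemma relW_diff {k k' : ℤ} (h : relW k k') : k' - k ∈ DD := by
  obtain ⟨h1, h2⟩ := h
  rw [mem_DD_iff]
  rw [abs_le] at h2
  rw [le_abs] at h1
  omega

lemma DD_abs {d : ℤ} (h : d ∈ DD) : 2 ≤ |d| ∧ |d| ≤ 5 := by
  rw [mem_DD_iff] at h
  rcases h with h | h | h | h <;> subst h <;> simp

open Classical in
noncomputable def Fc (f : ℝ × ℝ → ℂ) (m l d₁ d₂ k j : ℤ) (ξ : ℝ × ℝ) : ℂ :=
  if kf m ξ.1 = k ∧ kf l ξ.2 = j ∧ relW k (k + d₁) ∧ relW j (j + d₂) then f ξ else 0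

open Classical in
noncomputable def Gc (g : ℝ × ℝ → ℂ) (m l d₁ d₂ k j : ℤ) (ξ : ℝ × ℝ) : ℂ :=
  if kf m ξ.1 = k + d₁ ∧ kf l ξ.2 = j + d₂ then g ξ else 0

lemma kf_rect {m : ℤ} {x : ℝ} {k : ℤ} (h : kf m x = k) :
    x ∈ Icc ((k : ℝ) * 2 ^ (-m)) ((k : ℝ) * 2 ^ (-m) + 2 ^ (-m)) := by
  unfold kf at h
  have hp : (0 : ℝ) < 2 ^ m := by positivity
  have hq : (0 : ℝ) < 2 ^ (-m) := by positivity
  have e : (2 : ℝ) ^ m * 2 ^ (-m) = 1 := by rw [← zpow_add₀ (by norm_num)]; simp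
  have a1 := Int.floor_le ((2 : ℝ) ^ m * x)
  have a2 := Int.lt_floor_add_one ((2 : ℝ) ^ m * x)
  rw [h] at a1 a2
  have ex : x = (2 : ℝ) ^ m * x * 2 ^ (-m) := by rw [mul_right_comm, e, one_mul]
  constructor <;> nlinarith

lemma whitney_pt (f g : ℝ × ℝ → ℂ) (m l J K J' K' M₁ M₂ M₁' M₂' : ℤ)
    (hf : ∀ ξ, f ξ ≠ 0 → ξ ∈ tile J K M₁ M₂) (hg : ∀ ξ, g ξ ≠ 0 → ξ ∈ tile J' K' M₁' M₂')
    (z : (ℝ × ℝ) × (ℝ × ℝ)) :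
    (WS (m, l)).indicator (fun z => f z.1 * g z.2) z =
      ∑ d₁ ∈ DD, ∑ d₂ ∈ DD, ∑ k ∈ TD m J M₁ J' M₁' d₁, ∑ j ∈ TD l K M₂ K' M₂' d₂,
        Fc f m l d₁ d₂ k j z.1 * Gc g m l d₁ d₂ k j z.2 := by
  classical
  have hzero : ∀ d₁ d₂ k j, Fc f m l d₁ d₂ k j z.1 * Gc g m l d₁ d₂ k j z.2 ≠ 0 →
      z ∈ WS (m, l) ∧ f z.1 ≠ 0 ∧ g z.2 ≠ 0 ∧ kf m z.1.1 = k ∧ kf l z.1.2 = j ∧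
        d₁ = kf m z.2.1 - kf m z.1.1 ∧ d₂ = kf l z.2.2 - kf l z.1.2 := by
    intro d₁ d₂ k j hne
    have h1 := left_ne_zero_of_mul hne
    have h2 := right_ne_zero_of_mul hne
    unfold Fc at h1
    unfold Gc at h2
    split_ifs at h1 with c1
    · split_ifs at h2 with c2
      · obtain ⟨p1, p2, p3, p4⟩ := c1
        obtain ⟨q1, q2⟩ := c2
        refine ⟨⟨?_, ?_⟩, h1, h2, p1, p2, by omega, by omega⟩
        · simp only [p1, q1]; exact p3
        · simp only [p2, q2]; exact p4
      · exact absurd rfl h2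
    · exact absurd rfl h1
  by_cases hz : z ∈ WS (m, l) ∧ f z.1 ≠ 0 ∧ g z.2 ≠ 0
  · obtain ⟨hW, hfz, hgz⟩ := hz
    rw [indicator_of_mem hW]
    have hft := hf _ hfz
    have hgt := hg _ hgz
    have hW' := hW
    obtain ⟨w1, w2⟩ := hW
    simp only at w1 w2
    rw [Finset.sum_eq_single_of_mem (kf m z.2.1 - kf m z.1.1) (relW_diff w1)]
    · rw [Finset.sum_eq_single_of_mem (kf l z.2.2 - kf l z.1.2) (relW_diff w2)]
      · rw [Finset.sum_eq_single_of_mem (kf m z.1.1)]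
        · rw [Finset.sum_eq_single_of_mem (kf l z.1.2)]
          · unfold Fc Gc
            rw [if_pos, if_pos]
            · constructor <;> ring
            · refine ⟨rfl, rfl, ?_, ?_⟩
              · rw [add_sub_cancel]; exact w1
              · rw [add_sub_cancel]; exact w2
          · refine Finset.mem_filter.2 ⟨mem_TT hft.2, ?_⟩
            rw [add_sub_cancel]; exact mem_TT hgt.2
          · intro j _ hj
            by_contra hne
            exact hj (hzero _ _ _ _ hne).2.2.2.2.1.symm
        · refine Finset.mem_filter.2 ⟨mem_TT hft.1, ?_⟩
          rw [add_sub_cancel]; exact mem_TT hgt.1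
        · intro k _ hk
          refine Finset.sum_eq_zero fun j _ => ?_
          by_contra hne
          exact hk (hzero _ _ _ _ hne).2.2.2.1.symm
      · intro d₂ _ hd
        refine Finset.sum_eq_zero fun k _ => Finset.sum_eq_zero fun j _ => ?_
        by_contra hne
        exact hd (hzero _ _ _ _ hne).2.2.2.2.2.2
    · intro d₁ _ hd
      refine Finset.sum_eq_zero fun d₂ _ => Finset.sum_eq_zero fun k _ => Finset.sum_eq_zero fun j _ => ?_
      by_contra hne
      exact hd (hzero _ _ _ _ hne).2.2.2.2.2.1
  · have : (WS (m, l)).indicator (fun z => f z.1 * g z.2) z = 0 := by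
      by_cases hW : z ∈ WS (m, l)
      · rw [indicator_of_mem hW]
        by_contra hne
        exact hz ⟨hW, left_ne_zero_of_mul hne, right_ne_zero_of_mul hne⟩
      · rw [indicator_of_notMem hW]
    rw [this]
    symm
    refine Finset.sum_eq_zero fun d₁ _ => Finset.sum_eq_zero fun d₂ _ => Finset.sum_eq_zero fun k _ =>
      Finset.sum_eq_zero fun j _ => ?_
    by_contra hne
    have := hzero _ _ _ _ hne
    exact hz ⟨this.1, this.2.1, this.2.2.1⟩

lemma measurable_Fc {f : ℝ × ℝ → ℂ} (hf : Measurable f) (m l d₁ d₂ k j : ℤ) : Measurable (Fc f m l d₁ d₂ k j) := by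
  unfold Fc
  refine Measurable.ite ?_ hf measurable_const
  have h1 : Measurable (fun ξ : ℝ × ℝ => kf m ξ.1) := (measurable_kf m).comp measurable_fst
  have h2 : Measurable (fun ξ : ℝ × ℝ => kf l ξ.2) := (measurable_kf l).comp measurable_snd
  exact (h1 (measurableSet_singleton k)).inter ((h2 (measurableSet_singleton j)).inter
    (MeasurableSet.const _))

lemma measurable_Gc {f : ℝ × ℝ → ℂ} (hf : Measurable f) (m l d₁ d₂ k j : ℤ) : Measurable (Gc f m l d₁ d₂ k j) := by
  unfold Gc
  refine Measurable.ite ?_ hf measurable_const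
  have h1 : Measurable (fun ξ : ℝ × ℝ => kf m ξ.1) := (measurable_kf m).comp measurable_fst
  have h2 : Measurable (fun ξ : ℝ × ℝ => kf l ξ.2) := (measurable_kf l).comp measurable_snd
  exact (h1 (measurableSet_singleton _)).inter (h2 (measurableSet_singleton _))

lemma Fc_ne {f : ℝ × ℝ → ℂ} {m l d₁ d₂ k j : ℤ} {ξ : ℝ × ℝ} (h : Fc f m l d₁ d₂ k j ξ ≠ 0) :
    f ξ ≠ 0 ∧ ξ ∈ rect (2 ^ (-m)) (2 ^ (-l)) (k * 2 ^ (-m)) (j * 2 ^ (-l)) := by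
  unfold Fc at h
  split_ifs at h with c
  · exact ⟨h, kf_rect c.1, kf_rect c.2.1⟩
  · exact absurd rfl h

lemma Gc_ne {f : ℝ × ℝ → ℂ} {m l d₁ d₂ k j : ℤ} {ξ : ℝ × ℝ} (h : Gc f m l d₁ d₂ k j ξ ≠ 0) :
    f ξ ≠ 0 ∧ ξ ∈ rect (2 ^ (-m)) (2 ^ (-l)) ((k + d₁) * 2 ^ (-m)) ((j + d₂) * 2 ^ (-l)) := by
  unfold Gc at h
  split_ifs at h with c
  · refine ⟨h, ?_, ?_⟩
    · have := kf_rect c.1; push_cast at this; exact this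
    · have := kf_rect c.2; push_cast at this; exact this
  · exact absurd rfl h

lemma norm_Fc {f : ℝ × ℝ → ℂ} (hf : ∀ ξ, ‖f ξ‖ ≤ 1) (m l d₁ d₂ k j : ℤ) (ξ : ℝ × ℝ) :
    ‖Fc f m l d₁ d₂ k j ξ‖ ≤ 1 := by
  unfold Fc; split_ifs
  · exact hf ξ
  · simp

lemma norm_Gc {f : ℝ × ℝ → ℂ} (hf : ∀ ξ, ‖f ξ‖ ≤ 1) (m l d₁ d₂ k j : ℤ) (ξ : ℝ × ℝ) :
    ‖Gc f m l d₁ d₂ k j ξ‖ ≤ 1 := by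
  unfold Gc; split_ifs
  · exact hf ξ
  · simp

lemma vol_inter (a b u v : ℝ) (ha : 0 ≤ a) (hb : 0 ≤ b) (J K M₁ M₂ : ℤ) :
    volume (rect a b u v ∩ tile J K M₁ M₂) ≤ ENNReal.ofReal (min a (2 ^ (-J)) * min b (2 ^ (-K))) := by
  have h1 : ∀ (c w : ℝ) (n M : ℤ), volume (Icc w (w + c) ∩ dyadicIcc n M) ≤ ENNReal.ofReal (min c (2 ^ (-n))) := by
    intro c w n M
    rw [ENNReal.ofReal_min]
    refine le_min ?_ ?_
    · refine (measure_mono inter_subset_left).trans ?_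
      rw [Real.volume_Icc]; apply ENNReal.ofReal_le_ofReal; linarith
    · refine (measure_mono inter_subset_right).trans ?_
      unfold dyadicIcc
      rw [Real.volume_Icc]; apply ENNReal.ofReal_le_ofReal; linarith
  unfold rect tile
  rw [prod_inter_prod, Measure.volume_eq_prod, Measure.prod_prod, ENNReal.ofReal_mul (by positivity)]
  exact mul_le_mul' (h1 _ _ _ _) (h1 _ _ _ _)

noncomputable def Th (s r : ℝ) (m J J' : ℤ) : ℝ :=
  (3 * min (max 1 ((2 : ℝ) ^ (m - J))) (max 1 ((2 : ℝ) ^ (m - J')))) ^ (1 / s) *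
    ((2 : ℝ) ^ (-m)) ^ (2 * (1 - 1 / s) - 2 / r) *
    (min ((2 : ℝ) ^ (-m)) ((2 : ℝ) ^ (-J)) * min ((2 : ℝ) ^ (-m)) ((2 : ℝ) ^ (-J'))) ^ (1 / r)

lemma scale_est {s r A : ℝ} (hs : 1 < s) (hs2 : s ≤ 2) (hr : 0 < r) (hA : 0 ≤ A) (h : BH s r A)
    (f g : ℝ × ℝ → ℂ) (hfm : Measurable f) (hgm : Measurable g) (hfb : ∀ ξ, ‖f ξ‖ ≤ 1) (hgb : ∀ ξ, ‖g ξ‖ ≤ 1)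
    (m l J K J' K' M₁ M₂ M₁' M₂' : ℤ)
    (hf : ∀ ξ, f ξ ≠ 0 → ξ ∈ tile J K M₁ M₂) (hg : ∀ ξ, g ξ ≠ 0 → ξ ∈ tile J' K' M₁' M₂') :
    eLpNorm (fun p => ∫ z in WS (m, l), (ph p z.1 * ph p z.2) * (f z.1 * g z.2)) (ENNReal.ofReal s) volume ≤
      ENNReal.ofReal (16 * (Wc * (64 * A)) * (Th s r m J J' * Th s r l K K')) := by
  have hs0 : 0 < s := by linarith
  have hW := Wc_nonneg
  have ha : (0 : ℝ) < 2 ^ (-m) := by positivity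
  have hb : (0 : ℝ) < 2 ^ (-l) := by positivity
  have iF : ∀ d₁ d₂ k j, Integrable (Fc f m l d₁ d₂ k j) := fun d₁ d₂ k j =>
    integrable_of_rect (measurable_Fc hfm m l d₁ d₂ k j) (norm_Fc hfb m l d₁ d₂ k j) (fun ξ h => (Fc_ne h).2)
  have iG : ∀ d₁ d₂ k j, Integrable (Gc g m l d₁ d₂ k j) := fun d₁ d₂ k j =>
    integrable_of_rect (measurable_Gc hgm m l d₁ d₂ k j) (norm_Gc hgb m l d₁ d₂ k j) (fun ξ h => (Gc_ne h).2)
  have e : (fun p => ∫ z in WS (m, l), (ph p z.1 * ph p z.2) * (f z.1 * g z.2)) =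
      ∑ d₁ ∈ DD, ∑ d₂ ∈ DD, (fun p => ∑ k ∈ TD m J M₁ J' M₁' d₁, ∑ j ∈ TD l K M₂ K' M₂' d₂,
        extOp (Fc f m l d₁ d₂ k j) p * extOp (Gc g m l d₁ d₂ k j) p) := by
    ext p
    simp only [Finset.sum_apply]
    rw [← integral_indicator (measurableSet_WS _)]
    have hi : ∀ d₁ d₂ k j, Integrable (fun z : (ℝ × ℝ) × (ℝ × ℝ) => (ph p z.1 * ph p z.2) *
        (Fc f m l d₁ d₂ k j z.1 * Gc g m l d₁ d₂ k j z.2)) := fun d₁ d₂ k j =>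
      integrable_pp (iF d₁ d₂ k j) (iG d₁ d₂ k j) p
    have e2 : (WS (m, l)).indicator (fun z => (ph p z.1 * ph p z.2) * (f z.1 * g z.2)) =
        fun z => ∑ d₁ ∈ DD, ∑ d₂ ∈ DD, ∑ k ∈ TD m J M₁ J' M₁' d₁, ∑ j ∈ TD l K M₂ K' M₂' d₂,
          (ph p z.1 * ph p z.2) * (Fc f m l d₁ d₂ k j z.1 * Gc g m l d₁ d₂ k j z.2) := by
      ext z
      simp only [← Finset.mul_sum]
      rw [← whitney_pt f g m l J K J' K' M₁ M₂ M₁' M₂' hf hg z]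
      by_cases hz : z ∈ WS (m, l)
      · rw [indicator_of_mem hz, indicator_of_mem hz]
      · rw [indicator_of_notMem hz, indicator_of_notMem hz, mul_zero]
    rw [e2, integral_finsetSum _ fun d₁ _ => integrable_finsetSum _ fun d₂ _ =>
      integrable_finsetSum _ fun k _ => integrable_finsetSum _ fun j _ => hi d₁ d₂ k j]
    refine Finset.sum_congr rfl fun d₁ _ => ?_
    rw [integral_finsetSum _ fun d₂ _ => integrable_finsetSum _ fun k _ => integrable_finsetSum _ fun j _ => hi d₁ d₂ k j]
    refine Finset.sum_congr rfl fun d₂ _ => ?_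
    rw [integral_finsetSum _ fun k _ => integrable_finsetSum _ fun j _ => hi d₁ d₂ k j]
    refine Finset.sum_congr rfl fun k _ => ?_
    rw [integral_finsetSum _ fun j _ => hi d₁ d₂ k j]
    refine Finset.sum_congr rfl fun j _ => ?_
    rw [extOp_mul]
  have h1s : 1 ≤ ENNReal.ofReal s := by rw [ENNReal.one_le_ofReal]; exact hs.le
  have hcont : ∀ d₁ d₂, Continuous (fun p => ∑ k ∈ TD m J M₁ J' M₁' d₁, ∑ j ∈ TD l K M₂ K' M₂' d₂,
        extOp (Fc f m l d₁ d₂ k j) p * extOp (Gc g m l d₁ d₂ k j) p) := fun d₁ d₂ =>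
    continuous_finsetSum _ fun k _ => continuous_finsetSum _ fun j _ =>
      (continuous_extOp (iF d₁ d₂ k j)).mul (continuous_extOp (iG d₁ d₂ k j))
  set B : ℝ := Wc * (64 * A) * (Th s r m J J' * Th s r l K K') with hB
  have hT0 : ∀ m J J', 0 ≤ Th s r m J J' := fun m J J' => by unfold Th; positivity
  have hB0 : 0 ≤ B := mul_nonneg (by positivity) (mul_nonneg (hT0 _ _ _) (hT0 _ _ _))
  have hblock : ∀ d₁ ∈ DD, ∀ d₂ ∈ DD, eLpNorm (fun p => ∑ k ∈ TD m J M₁ J' M₁' d₁, ∑ j ∈ TD l K M₂ K' M₂' d₂,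
        extOp (Fc f m l d₁ d₂ k j) p * extOp (Gc g m l d₁ d₂ k j) p) (ENNReal.ofReal s) volume ≤ ENNReal.ofReal B := by
    intro d₁ hd₁ d₂ hd₂
    have mr : ∀ a b u v : ℝ, MeasurableSet (rect a b u v) := fun a b u v => measurableSet_Icc.prod measurableSet_Icc
    have mt : ∀ J K M N : ℤ, MeasurableSet (tile J K M N) := fun J K M N => measurableSet_Icc.prod measurableSet_Icc
    refine (block hs hs2 hr hA h ha hb d₁ d₂ (DD_abs hd₁).1 (DD_abs hd₁).2 (DD_abs hd₂).1 (DD_abs hd₂).2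
      (TD m J M₁ J' M₁' d₁) (TD l K M₂ K' M₂' d₂) (Fc f m l d₁ d₂) (Gc g m l d₁ d₂)
      (measurable_Fc hfm m l d₁ d₂) (measurable_Gc hgm m l d₁ d₂) (norm_Fc hfb m l d₁ d₂) (norm_Gc hgb m l d₁ d₂)
      (fun k j => rect (2 ^ (-m)) (2 ^ (-l)) (k * 2 ^ (-m)) (j * 2 ^ (-l)) ∩ tile J K M₁ M₂)
      (fun k j => rect (2 ^ (-m)) (2 ^ (-l)) ((k + d₁) * 2 ^ (-m)) ((j + d₂) * 2 ^ (-l)) ∩ tile J' K' M₁' M₂')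
      (fun k j => (mr _ _ _ _).inter (mt _ _ _ _)) (fun k j => (mr _ _ _ _).inter (mt _ _ _ _))
      (e := min (2 ^ (-m)) (2 ^ (-J)) * min (2 ^ (-l)) (2 ^ (-K)))
      (e' := min (2 ^ (-m)) (2 ^ (-J')) * min (2 ^ (-l)) (2 ^ (-K')))
      (by positivity) (by positivity) (fun k j => vol_inter _ _ _ _ ha.le hb.le _ _ _ _)
      (fun k j => vol_inter _ _ _ _ ha.le hb.le _ _ _ _)
      (fun k j ξ hn => ⟨(Fc_ne hn).2, hf ξ (Fc_ne hn).1⟩) (fun k j ξ hn => ⟨(Gc_ne hn).2, hg ξ (Gc_ne hn).1⟩)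
      (fun k j ξ hn => (Fc_ne hn).2) (fun k j ξ hn => (Gc_ne hn).2)).trans ?_
    apply ENNReal.ofReal_le_ofReal
    rw [hB]
    refine mul_le_mul_of_nonneg_left ?_ (by positivity)
    unfold Th
    set N₁ := 3 * min (max 1 ((2 : ℝ) ^ (m - J))) (max 1 ((2 : ℝ) ^ (m - J')))
    set N₂ := 3 * min (max 1 ((2 : ℝ) ^ (l - K))) (max 1 ((2 : ℝ) ^ (l - K')))
    have hN₁ := card_TD m J M₁ J' M₁' d₁
    have hN₂ := card_TD l K M₂ K' M₂' d₂
    have n1 : (0 : ℝ) ≤ N₁ := by positivity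
    have n2 : (0 : ℝ) ≤ N₂ := by positivity
    calc _ ≤ (N₁ * N₂) ^ (1 / s) * (((2 : ℝ) ^ (-m) * 2 ^ (-l)) ^ (2 * (1 - 1 / s) - 2 / r) *
          (min (2 ^ (-m)) (2 ^ (-J)) * min (2 ^ (-l)) (2 ^ (-K)) *
            (min (2 ^ (-m)) (2 ^ (-J')) * min (2 ^ (-l)) (2 ^ (-K')))) ^ (1 / r)) := by
          gcongr
      _ = _ := by
          rw [Real.mul_rpow n1 n2, Real.mul_rpow ha.le hb.le]
          rw [show (min ((2 : ℝ) ^ (-m)) (2 ^ (-J)) * min (2 ^ (-l)) (2 ^ (-K)) *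
            (min (2 ^ (-m)) (2 ^ (-J')) * min (2 ^ (-l)) (2 ^ (-K')))) =
            (min ((2 : ℝ) ^ (-m)) (2 ^ (-J)) * min (2 ^ (-m)) (2 ^ (-J'))) *
            (min (2 ^ (-l)) (2 ^ (-K)) * min (2 ^ (-l)) (2 ^ (-K'))) by ring,
            Real.mul_rpow (x := min ((2 : ℝ) ^ (-m)) (2 ^ (-J)) * min (2 ^ (-m)) (2 ^ (-J')))
              (y := min ((2 : ℝ) ^ (-l)) (2 ^ (-K)) * min (2 ^ (-l)) (2 ^ (-K'))) (by positivity) (by positivity)]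
          ring
  rw [e]
  refine (eLpNorm_sum_le (fun d₁ _ => Finset.aestronglyMeasurable_sum _ fun d₂ _ => (hcont d₁ d₂).aestronglyMeasurable) h1s).trans ?_
  refine (Finset.sum_le_sum fun d₁ hd₁ => (eLpNorm_sum_le (fun d₂ _ => (hcont d₁ d₂).aestronglyMeasurable) h1s).trans
    (Finset.sum_le_sum fun d₂ hd₂ => hblock d₁ hd₁ d₂ hd₂)).trans ?_
  simp only [Finset.sum_const, DD]
  have e16 : 16 * (Wc * (64 * A)) * (Th s r m J J' * Th s r l K K') = 16 * B := by rw [hB]; ring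
  rw [e16]
  clear_value B
  rw [ENNReal.ofReal_mul (by norm_num)]
  simp [← mul_assoc]
  norm_num


lemma expo_ineq (q ρ c m J J' : ℝ) (h1 : c ≤ q) (h2 : 2 * c ≤ 3 * q - 1) (h3 : c ≤ ρ - q) (hc : 0 ≤ c) (hq : q ≤ 1 / 2) :
    (1 - q) * min (max 0 (m - J)) (max 0 (m - J')) - m * (2 * q - 2 * ρ) + ρ * (min (-m) (-J) + min (-m) (-J')) ≤
      -q * (J + J') - c * (|m - J| + |m - J'|) := by
  wlog hJ : J ≤ J' generalizing J J'
  · have := this J' J (le_of_not_ge hJ)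
    rw [min_comm, add_comm (min (-m) (-J)), add_comm J, add_comm |m - J|]
    exact this
  rcases le_total m J with h | h
  · rw [max_eq_left (by linarith), max_eq_left (by linarith), min_self, min_eq_right (by linarith),
      min_eq_right (by linarith), abs_of_nonpos (by linarith), abs_of_nonpos (by linarith)]
    nlinarith
  · rcases le_total m J' with h' | h'
    · rw [max_eq_right (by linarith), max_eq_left (by linarith : m - J' ≤ 0), min_eq_right (by linarith : (0:ℝ) ≤ m - J),
        min_eq_left (by linarith), min_eq_right (by linarith), abs_of_nonneg (by linarith), abs_of_nonpos (by linarith)]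
      nlinarith
    · rw [max_eq_right (by linarith), max_eq_right (by linarith : 0 ≤ m - J'), min_eq_right (by linarith : m - J' ≤ m - J),
        min_eq_left (by linarith), min_eq_left (by linarith), abs_of_nonneg (by linarith), abs_of_nonneg (by linarith)]
      nlinarith [mul_nonneg (sub_nonneg.2 h1) (sub_nonneg.2 hJ), mul_nonneg (sub_nonneg.2 h2) (sub_nonneg.2 h')]

lemma phi_mono : Monotone (fun x : ℝ => (2 : ℝ) ^ x) := fun _ _ h => Real.rpow_le_rpow_of_exponent_le (by norm_num) h

lemma Th_le {s r c : ℝ} (hs : 1 < s) (hs2 : s ≤ 2) (hr : 0 < r) (hc : 0 ≤ c) (h1 : c ≤ 1 - 1 / s)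
    (h2 : 2 * c ≤ 3 * (1 - 1 / s) - 1) (h3 : c ≤ 1 / r - (1 - 1 / s)) (m J J' : ℤ) :
    Th s r m J J' ≤ 3 * (2 : ℝ) ^ (-(1 - 1 / s) * ((J : ℝ) + J') - c * (|(m : ℝ) - J| + |(m : ℝ) - J'|)) := by
  have hz : ∀ n : ℤ, (2 : ℝ) ^ n = (2 : ℝ) ^ (n : ℝ) := fun n => (Real.rpow_intCast _ _).symm
  have hmax : ∀ x : ℝ, max 1 ((2 : ℝ) ^ x) = (2 : ℝ) ^ (max 0 x) := by
    intro x
    have := phi_mono.map_max (a := 0) (b := x)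
    simp only [Real.rpow_zero] at this
    exact this.symm
  have hmin : ∀ x y : ℝ, min ((2 : ℝ) ^ x) ((2 : ℝ) ^ y) = (2 : ℝ) ^ (min x y) := by
    intro x y
    exact (phi_mono.map_min (a := x) (b := y)).symm
  unfold Th
  simp only [hz, hmax, hmin]
  rw [Real.mul_rpow (by norm_num) (by positivity), ← Real.rpow_add (by norm_num), ← Real.rpow_mul (by norm_num),
    ← Real.rpow_mul (by norm_num), ← Real.rpow_mul (by norm_num), mul_assoc, mul_assoc, ← Real.rpow_add (by norm_num),
    ← Real.rpow_add (by norm_num)]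
  have h13 : (3 : ℝ) ^ (1 / s) ≤ 3 := by
    conv_rhs => rw [← Real.rpow_one 3]
    apply Real.rpow_le_rpow_of_exponent_le (by norm_num)
    rw [div_le_one (by linarith)]; linarith
  have hq : 1 - 1 / s ≤ 1 / 2 := by
    have : 1 / 2 ≤ 1 / s := one_div_le_one_div_of_le (by linarith) hs2
    linarith
  refine mul_le_mul h13 ?_ (by positivity) (by norm_num)
  apply phi_mono
  have := expo_ineq (1 - 1 / s) (1 / r) c m J J' h1 h2 h3 hc hq
  push_cast
  refine le_trans (le_of_eq ?_) this
  ring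

noncomputable def Sg (c : ℝ) : ℝ≥0∞ := ∑' n : ℤ, ENNReal.ofReal ((2 : ℝ) ^ (-(c * |(n : ℝ)|)))

lemma Sg_ne_top {c : ℝ} (hc : 0 < c) : Sg c ≠ ⊤ := by
  have hn : Summable (fun n : ℕ => (2 : ℝ) ^ (-(c * |((n : ℤ) : ℝ)|))) := by
    have : Summable (fun n : ℕ => ((2 : ℝ) ^ (-c)) ^ n) :=
      summable_geometric_of_lt_one (by positivity) (Real.rpow_lt_one_of_one_lt_of_neg (by norm_num) (by linarith))
    refine this.congr fun n => ?_
    rw [← Real.rpow_natCast, ← Real.rpow_mul (by norm_num)]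
    congr 1
    simp
  have hs : Summable (fun n : ℤ => (2 : ℝ) ^ (-(c * |(n : ℝ)|))) := by
    refine Summable.of_nat_of_neg hn ?_
    simpa using hn
  exact hs.tsum_ofReal_ne_top

lemma Sg_shift (c : ℝ) (J : ℤ) : ∑' n : ℤ, ENNReal.ofReal ((2 : ℝ) ^ (-(c * |(n : ℝ) - J|))) = Sg c := by
  unfold Sg
  rw [← (Equiv.subRight J).tsum_eq (fun n : ℤ => ENNReal.ofReal ((2 : ℝ) ^ (-(c * |(n : ℝ)|))))]
  congr 1; ext n
  simp

lemma tile_pair {s r A c : ℝ} (hs : 1 < s) (hs2 : s ≤ 2) (hr : 0 < r) (hA : 0 ≤ A) (h : BH s r A)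
    (hc : 0 ≤ c) (h1 : c ≤ 1 - 1 / s)
    (h2 : 2 * c ≤ 3 * (1 - 1 / s) - 1) (h3 : c ≤ 1 / r - (1 - 1 / s))
    (f g : ℝ × ℝ → ℂ) (hfm : Measurable f) (hgm : Measurable g) (hfb : ∀ ξ, ‖f ξ‖ ≤ 1) (hgb : ∀ ξ, ‖g ξ‖ ≤ 1)
    (J K J' K' M₁ M₂ M₁' M₂' : ℤ)
    (hf : ∀ ξ, f ξ ≠ 0 → ξ ∈ tile J K M₁ M₂) (hg : ∀ ξ, g ξ ≠ 0 → ξ ∈ tile J' K' M₁' M₂') :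
    eLpNorm (fun p => extOp f p * extOp g p) (ENNReal.ofReal s) volume ≤
      ENNReal.ofReal (9216 * (Wc * A)) * Sg (c / 2) ^ 2 *
        ENNReal.ofReal ((2 : ℝ) ^ (-(1 - 1 / s) * ((J : ℝ) + K)) * (2 : ℝ) ^ (-(1 - 1 / s) * ((J' : ℝ) + K')) *
          (2 : ℝ) ^ (-(c / 2 * |(K : ℝ) - K'|))) := by
  have hW := Wc_nonneg
  have hrect : ∀ J K M₁ M₂ : ℤ, tile J K M₁ M₂ = rect (2 ^ (-J)) (2 ^ (-K)) (M₁ * 2 ^ (-J)) (M₂ * 2 ^ (-K)) := by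
    intro J K M₁ M₂
    unfold tile rect dyadicIcc
    congr 2 <;> ring
  have iF : Integrable f := integrable_of_rect hfm hfb (fun ξ hx => by rw [← hrect]; exact hf ξ hx)
  have iG : Integrable g := integrable_of_rect hgm hgb (fun ξ hx => by rw [← hrect]; exact hg ξ hx)
  have h1s : 1 ≤ ENNReal.ofReal s := by rw [ENNReal.one_le_ofReal]; exact hs.le
  have hT0 : ∀ m J J', 0 ≤ Th s r m J J' := fun m J J' => by unfold Th; positivity
  have hmeas : ∀ i : ℤ × ℤ, AEStronglyMeasurable (fun p => ∫ z in WS i, (ph p z.1 * ph p z.2) * (f z.1 * g z.2)) volume := by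
    intro i
    have hcc : Continuous (fun w : (ℝ × ℝ × ℝ) × ((ℝ × ℝ) × (ℝ × ℝ)) => ph w.1 w.2.1 * ph w.1 w.2.2) :=
      (continuous_ph.comp (continuous_fst.prodMk (continuous_fst.comp continuous_snd))).mul
        (continuous_ph.comp (continuous_fst.prodMk (continuous_snd.comp continuous_snd)))
    have hmm : Measurable (fun w : (ℝ × ℝ × ℝ) × ((ℝ × ℝ) × (ℝ × ℝ)) =>
        (ph w.1 w.2.1 * ph w.1 w.2.2) * (f w.2.1 * g w.2.2)) :=
      hcc.measurable.mul ((hfm.comp (measurable_fst.comp measurable_snd)).mul (hgm.comp (measurable_snd.comp measurable_snd)))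
    exact (hmm.stronglyMeasurable.integral_prod_right (ν := volume.restrict (WS i))).aestronglyMeasurable
  have hsum := eLpNorm_hasSum_le (μ := volume) h1s
    (fun (i : ℤ × ℤ) p => ∫ z in WS i, (ph p z.1 * ph p z.2) * (f z.1 * g z.2)) hmeas
    (fun p => extOp f p * extOp g p) (fun p => by
      rw [extOp_mul]
      exact hasSum_WS (integrable_pp iF iG p))
  refine hsum.trans ?_
  have hth : ∀ m J J' : ℤ, ENNReal.ofReal (Th s r m J J') ≤
      ENNReal.ofReal (3 * (2 : ℝ) ^ (-(1 - 1 / s) * ((J : ℝ) + J')) * (2 : ℝ) ^ (-(c / 2 * |(J : ℝ) - J'|))) *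
        ENNReal.ofReal ((2 : ℝ) ^ (-(c / 2 * |(m : ℝ) - J|))) := by
    intro m J J'
    rw [← ENNReal.ofReal_mul (by positivity)]
    apply ENNReal.ofReal_le_ofReal
    refine (Th_le hs hs2 hr hc h1 h2 h3 m J J').trans ?_
    rw [mul_assoc, mul_assoc, ← Real.rpow_add (by norm_num), ← Real.rpow_add (by norm_num)]
    refine mul_le_mul_of_nonneg_left (phi_mono ?_) (by norm_num)
    have t1 : |(J : ℝ) - J'| ≤ |(m : ℝ) - J| + |(m : ℝ) - J'| := by
      rw [abs_sub_comm (m : ℝ) J]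
      exact abs_sub_le _ _ _
    have t2 := abs_nonneg ((m : ℝ) - J')
    nlinarith
  calc ∑' i : ℤ × ℤ, eLpNorm (fun p => ∫ z in WS i, (ph p z.1 * ph p z.2) * (f z.1 * g z.2)) (ENNReal.ofReal s) volume
      ≤ ∑' i : ℤ × ℤ, ENNReal.ofReal (16 * (Wc * (64 * A))) *
          (ENNReal.ofReal (Th s r i.1 J J') * ENNReal.ofReal (Th s r i.2 K K')) := by
        refine ENNReal.tsum_le_tsum fun i => ?_
        refine (scale_est hs hs2 hr hA h f g hfm hgm hfb hgb i.1 i.2 J K J' K' M₁ M₂ M₁' M₂' hf hg).trans (le_of_eq ?_)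
        rw [ENNReal.ofReal_mul (by positivity), ENNReal.ofReal_mul (hT0 _ _ _)]
    _ = ENNReal.ofReal (16 * (Wc * (64 * A))) * ((∑' m, ENNReal.ofReal (Th s r m J J')) * ∑' l, ENNReal.ofReal (Th s r l K K')) := by
        rw [ENNReal.tsum_mul_left]
        congr 1
        rw [ENNReal.tsum_prod (f := fun m l => ENNReal.ofReal (Th s r m J J') * ENNReal.ofReal (Th s r l K K')),
          ← ENNReal.tsum_mul_right]
        congr 1; ext m
        rw [ENNReal.tsum_mul_left]
    _ ≤ ENNReal.ofReal (16 * (Wc * (64 * A))) *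
        ((ENNReal.ofReal (3 * (2 : ℝ) ^ (-(1 - 1 / s) * ((J : ℝ) + J')) * (2 : ℝ) ^ (-(c / 2 * |(J : ℝ) - J'|))) * Sg (c / 2)) *
        (ENNReal.ofReal (3 * (2 : ℝ) ^ (-(1 - 1 / s) * ((K : ℝ) + K')) * (2 : ℝ) ^ (-(c / 2 * |(K : ℝ) - K'|))) * Sg (c / 2))) := by
        have := fun J J' : ℤ => (ENNReal.tsum_le_tsum fun m => hth m J J').trans (le_of_eq (by
          rw [ENNReal.tsum_mul_left, Sg_shift]))
        exact mul_le_mul' le_rfl (mul_le_mul' (this J J') (this K K'))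
    _ ≤ ENNReal.ofReal (16 * (Wc * (64 * A))) *
        ((ENNReal.ofReal (3 * (2 : ℝ) ^ (-(1 - 1 / s) * ((J : ℝ) + J'))) * Sg (c / 2)) *
        (ENNReal.ofReal (3 * (2 : ℝ) ^ (-(1 - 1 / s) * ((K : ℝ) + K')) * (2 : ℝ) ^ (-(c / 2 * |(K : ℝ) - K'|))) * Sg (c / 2))) := by
        refine mul_le_mul' le_rfl (mul_le_mul' (mul_le_mul' (ENNReal.ofReal_le_ofReal ?_) le_rfl) le_rfl)
        refine mul_le_of_le_one_right (by positivity) ?_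
        apply Real.rpow_le_one_of_one_le_of_nonpos (by norm_num)
        have := abs_nonneg ((J : ℝ) - J')
        nlinarith
    _ = _ := by
        have e1 : (2 : ℝ) ^ (-(1 - 1 / s) * ((J : ℝ) + K)) * (2 : ℝ) ^ (-(1 - 1 / s) * ((J' : ℝ) + K')) =
          (2 : ℝ) ^ (-(1 - 1 / s) * ((J : ℝ) + J')) * (2 : ℝ) ^ (-(1 - 1 / s) * ((K : ℝ) + K')) := by
          rw [← Real.rpow_add (by norm_num), ← Real.rpow_add (by norm_num)]
          congr 1; ring
        rw [e1]
        set x := (2 : ℝ) ^ (-(1 - 1 / s) * ((J : ℝ) + J')) with hx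
        set y := (2 : ℝ) ^ (-(1 - 1 / s) * ((K : ℝ) + K')) with hy
        set w := (2 : ℝ) ^ (-(c / 2 * |(K : ℝ) - K'|)) with hw
        have x0 : 0 ≤ x := by positivity
        have y0 : 0 ≤ y := by positivity
        have w0 : 0 ≤ w := by positivity
        clear_value x y w
        calc _ = ENNReal.ofReal (16 * (Wc * (64 * A))) * ENNReal.ofReal (3 * x) * ENNReal.ofReal (3 * y * w) * Sg (c / 2) ^ 2 := by ring
          _ = ENNReal.ofReal (9216 * (Wc * A)) * ENNReal.ofReal (x * y * w) * Sg (c / 2) ^ 2 := by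
            rw [← ENNReal.ofReal_mul (by positivity), ← ENNReal.ofReal_mul (by positivity), ← ENNReal.ofReal_mul (by positivity)]
            congr 2; ring
          _ = _ := by ring


lemma integrable_chi {A : Set (ℝ × ℝ)} (hA : MeasurableSet A) (hv : volume A ≠ ⊤) : Integrable (chi A) := by
  unfold chi
  exact (integrable_indicator_iff hA).2 (integrableOn_const (by exact hv))

lemma extOp_add {f g : ℝ × ℝ → ℂ} (hf : Integrable f) (hg : Integrable g) (p : ℝ × ℝ × ℝ) :
    extOp (fun ξ => f ξ + g ξ) p = extOp f p + extOp g p := by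
  rw [extOp_eq, extOp_eq, extOp_eq, ← integral_add (integrable_ph hf p) (integrable_ph hg p)]
  congr 1; ext ξ; ring

lemma tiles_left {ι : Type*} [DecidableEq ι] {q : ℝ≥0∞} (hq : 1 ≤ q) (S : ι → Set (ℝ × ℝ)) (hS : ∀ i, MeasurableSet (S i))
    (Φ : ℝ × ℝ × ℝ → ℂ) (hΦ : Continuous Φ) (M : ℝ≥0∞)
    (hM : ∀ i A, MeasurableSet A → volume A ≠ ⊤ → A ⊆ S i → eLpNorm (fun p => extOp (chi A) p * Φ p) q volume ≤ M)
    (T : Finset ι) : ∀ A, MeasurableSet A → volume A ≠ ⊤ → A ⊆ (⋃ i ∈ T, S i) →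
      eLpNorm (fun p => extOp (chi A) p * Φ p) q volume ≤ T.card * M := by
  induction T using Finset.induction_on with
  | empty =>
    intro A _ _ h
    have : A = ∅ := by simpa using h
    subst this
    have : (fun p => extOp (chi ∅) p * Φ p) = fun _ => (0:ℂ) := by
      ext p
      simp [extOp, chi]
    rw [this]
    simp
  | insert a T ha ih =>
    intro A hA hv h
    have m1 : MeasurableSet (A ∩ S a) := hA.inter (hS a)
    have m2 : MeasurableSet (A \ S a) := hA.diff (hS a)
    have v1 : volume (A ∩ S a) ≠ ⊤ := measure_ne_top_of_subset inter_subset_left hv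
    have v2 : volume (A \ S a) ≠ ⊤ := measure_ne_top_of_subset sdiff_subset hv
    have i1 := integrable_chi m1 v1
    have i2 := integrable_chi m2 v2
    have e : chi A = fun ξ => chi (A ∩ S a) ξ + chi (A \ S a) ξ := by
      ext ξ
      unfold chi
      by_cases h1 : ξ ∈ A <;> by_cases h2 : ξ ∈ S a <;> simp [indicator, h1, h2]
    have e2 : (fun p => extOp (chi A) p * Φ p) =
        (fun p => extOp (chi (A ∩ S a)) p * Φ p) + (fun p => extOp (chi (A \ S a)) p * Φ p) := by
      ext p
      rw [e, extOp_add i1 i2]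
      simp only [Pi.add_apply]
      ring
    rw [e2, Finset.card_insert_of_notMem ha]
    refine (eLpNorm_add_le ((continuous_extOp i1).mul hΦ).aestronglyMeasurable
      ((continuous_extOp i2).mul hΦ).aestronglyMeasurable hq).trans ?_
    have b1 := hM a _ m1 v1 inter_subset_right
    have b2 := ih _ m2 v2 (by
      rintro ξ ⟨h1, h2⟩
      have := h h1
      simp only [Finset.mem_insert, mem_iUnion] at this ⊢
      obtain ⟨i, hi | hi, hx⟩ := this
      · subst hi; exact absurd hx h2
      · exact ⟨i, hi, hx⟩)
    push_cast
    rw [add_mul, one_mul, add_comm]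
    exact add_le_add b2 b1

lemma measurableSet_tile (J K m m' : ℤ) : MeasurableSet (tile J K m m') :=
  measurableSet_Icc.prod measurableSet_Icc

lemma chi_meas {A : Set (ℝ × ℝ)} (hA : MeasurableSet A) : Measurable (chi A) :=
  measurable_const.indicator hA

lemma chi_norm (A : Set (ℝ × ℝ)) (ξ) : ‖chi A ξ‖ ≤ 1 := by
  unfold chi
  by_cases h : ξ ∈ A <;> simp [h]

lemma chi_supp {A : Set (ℝ × ℝ)} {ξ} (h : chi A ξ ≠ 0) : ξ ∈ A := by
  by_contra hh
  exact h (by simp [chi, hh])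

lemma tiles_pair {s r A c : ℝ} (hs : 1 < s) (hs2 : s ≤ 2) (hr : 0 < r) (hA : 0 ≤ A) (h : BH s r A)
    (hc : 0 ≤ c) (h1 : c ≤ 1 - 1 / s)
    (h2 : 2 * c ≤ 3 * (1 - 1 / s) - 1) (h3 : c ≤ 1 / r - (1 - 1 / s))
    (J K J' K' : ℤ) (T T' : Finset (ℤ × ℤ)) (U U' : Set (ℝ × ℝ)) (hU : MeasurableSet U) (hU' : MeasurableSet U')
    (vU : volume U ≠ ⊤) (vU' : volume U' ≠ ⊤)
    (hT : U ⊆ ⋃ p ∈ T, tile J K p.1 p.2) (hT' : U' ⊆ ⋃ p ∈ T', tile J' K' p.1 p.2) :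
    eLpNorm (fun p => extOp (chi U) p * extOp (chi U') p) (ENNReal.ofReal s) volume ≤
      T.card * (T'.card * (ENNReal.ofReal (9216 * (Wc * A)) * Sg (c / 2) ^ 2 *
        ENNReal.ofReal ((2 : ℝ) ^ (-(1 - 1 / s) * ((J : ℝ) + K)) * (2 : ℝ) ^ (-(1 - 1 / s) * ((J' : ℝ) + K')) *
          (2 : ℝ) ^ (-(c / 2 * |(K : ℝ) - K'|))))) := by
  have h1s : 1 ≤ ENNReal.ofReal s := by rw [ENNReal.one_le_ofReal]; exact hs.le
  refine tiles_left h1s (fun p : ℤ × ℤ => tile J K p.1 p.2) (fun p => measurableSet_tile _ _ _ _) _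
    (continuous_extOp (integrable_chi hU' vU')) _ ?_ T U hU vU hT
  intro i V hV vV hVi
  simp only [mul_comm (extOp (chi V) _)]
  refine tiles_left h1s (fun p : ℤ × ℤ => tile J' K' p.1 p.2) (fun p => measurableSet_tile _ _ _ _) _
    (continuous_extOp (integrable_chi hV vV)) _ ?_ T' U' hU' vU' hT'
  intro j V' hV' vV' hVj
  simp only [mul_comm (extOp (chi V') _)]
  exact tile_pair hs hs2 hr hA h hc h1 h2 h3 _ _ (chi_meas hV) (chi_meas hV') (chi_norm _) (chi_norm _)
    J K J' K' i.1 i.2 j.1 j.2 (fun ξ hx => hVi (chi_supp hx)) (fun ξ hx => hVj (chi_supp hx))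

/-- volumes -/
lemma fiberPiece_eq (Ω : Set (ℝ × ℝ)) (K : ℕ) : fiberPiece Ω K = Ω ∩ Prod.fst ⁻¹' {x | (2 : ℝ≥0∞) ^ (-(K : ℤ) - 1) ≤ volume (vFiber Ω x) ∧
    volume (vFiber Ω x) ≤ (2 : ℝ≥0∞) ^ (-(K : ℤ) + 1)} := by
  ext ξ; exact Iff.rfl

lemma meas_base {Ω : Set (ℝ × ℝ)} (hΩ : MeasurableSet Ω) (a b : ℝ≥0∞) :
    MeasurableSet {x | a ≤ volume (vFiber Ω x) ∧ volume (vFiber Ω x) ≤ b} := by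
  have : Measurable (fun x => volume (vFiber Ω x)) := measurable_measure_prodMk_left hΩ
  exact (measurableSet_le measurable_const this).inter (measurableSet_le this measurable_const)

lemma meas_fiberPiece {Ω : Set (ℝ × ℝ)} (hΩ : MeasurableSet Ω) (K : ℕ) : MeasurableSet (fiberPiece Ω K) := by
  rw [fiberPiece_eq]
  exact hΩ.inter (measurable_fst (meas_base hΩ _ _))

lemma vol_fiberPiece {Ω : Set (ℝ × ℝ)} (hΩ : MeasurableSet Ω) (K : ℕ) :
    (2 : ℝ≥0∞) ^ (-(K : ℤ) - 1) * volume (Prod.fst '' fiberPiece Ω K) ≤ volume (fiberPiece Ω K) := by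
  set P := {x | (2 : ℝ≥0∞) ^ (-(K : ℤ) - 1) ≤ volume (vFiber Ω x) ∧
    volume (vFiber Ω x) ≤ (2 : ℝ≥0∞) ^ (-(K : ℤ) + 1)} with hP
  have hsub : Prod.fst '' fiberPiece Ω K ⊆ P := by
    rintro _ ⟨ξ, hx, rfl⟩
    rw [fiberPiece_eq] at hx
    exact hx.2
  have mP : MeasurableSet P := meas_base hΩ _ _
  calc _ ≤ (2 : ℝ≥0∞) ^ (-(K : ℤ) - 1) * volume P := mul_le_mul' le_rfl (measure_mono hsub)
    _ = ∫⁻ _ in P, (2 : ℝ≥0∞) ^ (-(K : ℤ) - 1) := by simp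
    _ ≤ ∫⁻ x in P, volume (Prod.mk x ⁻¹' fiberPiece Ω K) := by
      refine setLIntegral_mono' mP fun x hx => ?_
      have : Prod.mk x ⁻¹' fiberPiece Ω K = vFiber Ω x := by
        ext y
        rw [fiberPiece_eq]
        exact ⟨fun h => h.1, fun h => ⟨h, hx⟩⟩
      rw [this]
      exact hx.1
    _ ≤ ∫⁻ x, volume (Prod.mk x ⁻¹' fiberPiece Ω K) := setLIntegral_le_lintegral _ _
    _ = volume (fiberPiece Ω K) := by
      rw [Measure.volume_eq_prod, Measure.prod_apply (meas_fiberPiece hΩ K)]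

lemma vol_lower {Ω : Set (ℝ × ℝ)} (hΩ : MeasurableSet Ω) (K J : ℕ)
    (hJ : (2 : ℝ≥0∞) ^ (-(J : ℤ) - 1) ≤ volume (Prod.fst '' fiberPiece Ω K)) {q : ℝ} (hq : 0 ≤ q) :
    ENNReal.ofReal ((2 : ℝ) ^ (-q * ((J : ℝ) + K))) ≤ ENNReal.ofReal ((4 : ℝ) ^ q) * volume (fiberPiece Ω K) ^ q := by
  have h1 := (mul_le_mul' (le_refl ((2 : ℝ≥0∞) ^ (-(K : ℤ) - 1))) hJ).trans (vol_fiberPiece hΩ K)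
  have h2 := ENNReal.rpow_le_rpow h1 hq
  refine le_trans (le_of_eq ?_) (mul_le_mul' le_rfl h2)
  have e : ∀ n : ℤ, (2 : ℝ≥0∞) ^ n = ENNReal.ofReal ((2 : ℝ) ^ (n : ℝ)) := by
    intro n
    rw [← ENNReal.ofReal_rpow_of_pos (by norm_num), ENNReal.rpow_intCast]; simp
  rw [e, e, ← ENNReal.ofReal_mul (by positivity), ENNReal.ofReal_rpow_of_pos (by positivity), ← ENNReal.ofReal_mul (by positivity)]
  congr 1
  rw [← Real.rpow_add (by norm_num), ← Real.rpow_mul (by norm_num), show (4 : ℝ) = 2 ^ (2 : ℝ) by norm_num,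
    ← Real.rpow_mul (by norm_num), ← Real.rpow_add (by norm_num)]
  congr 1
  push_cast
  ring

lemma card_three (v : ℝ≥0∞) (K K' : ℕ) (h : (2 : ℝ≥0∞) ^ (-(K : ℤ) - 1) ≤ v) (h' : v ≤ (2 : ℝ≥0∞) ^ (-(K' : ℤ) + 1)) :
    K' ≤ K + 2 := by
  have h3 := h.trans h'
  by_contra hh
  have : (2 : ℝ≥0∞) ^ (-(K' : ℤ) + 1) < (2 : ℝ≥0∞) ^ (-(K : ℤ) - 1) := by
    have e : ∀ n : ℤ, (2 : ℝ≥0∞) ^ n = ENNReal.ofReal ((2 : ℝ) ^ n) := by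
      intro n
      rw [← Real.rpow_intCast, ← ENNReal.ofReal_rpow_of_pos (by norm_num), ENNReal.rpow_intCast]; simp
    rw [e, e, ENNReal.ofReal_lt_ofReal_iff (by positivity)]
    exact zpow_lt_zpow_right₀ (by norm_num) (by omega)
  exact absurd h3 (not_le.2 this)

lemma sum_vol {Ω : Set (ℝ × ℝ)} (hΩ : MeasurableSet Ω) : ∑' K, volume (fiberPiece Ω K) ≤ 3 * volume Ω := by
  have h1 : ∀ K, volume (fiberPiece Ω K) = ∫⁻ ξ, (fiberPiece Ω K).indicator (fun _ => (1 : ℝ≥0∞)) ξ := by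
    intro K
    rw [lintegral_indicator (meas_fiberPiece hΩ K)]; simp
  simp_rw [h1]
  rw [← lintegral_tsum (fun K => (measurable_const.indicator (meas_fiberPiece hΩ K)).aemeasurable)]
  have h2 : 3 * volume Ω = ∫⁻ ξ, Ω.indicator (fun _ => (3 : ℝ≥0∞)) ξ := by
    rw [lintegral_indicator hΩ]; simp
  rw [h2]
  refine lintegral_mono fun ξ => ?_
  by_cases hx : ∃ K, ξ ∈ fiberPiece Ω K
  · classical
    have hK := Nat.find_spec hx
    set K := Nat.find hx
    have hmin : ∀ K', ξ ∈ fiberPiece Ω K' → K' ∈ Finset.Icc K (K + 2) := by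
      intro K' hK'
      exact Finset.mem_Icc.2 ⟨Nat.find_min' hx hK', card_three _ K K' hK.2.1 hK'.2.2⟩
    rw [tsum_eq_sum (s := Finset.Icc K (K + 2)) (fun K' hK' => by
      rw [indicator_of_notMem]; exact fun h => hK' (hmin _ h)), indicator_of_mem hK.1]
    refine (Finset.sum_le_card_nsmul _ _ 1 (fun K' _ => indicator_le_self' (by simp) ξ)).trans ?_
    rw [Nat.card_Icc, show K + 2 + 1 - K = 3 by omega]
    simp
  · push Not at hx
    simp [hx]


lemma enn_two_mul_le (x y : ℝ≥0∞) : x * y ≤ x ^ 2 + y ^ 2 := by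
  rcases le_total x y with h | h
  · exact (mul_le_mul' h le_rfl).trans (by rw [sq y]; exact le_add_self)
  · exact (mul_le_mul' le_rfl h).trans (by rw [sq x]; exact le_self_add)

lemma schurE {ι : Type*} (u : ι → ι → ℝ≥0∞) (hsym : ∀ i j, u i j = u j i) (S : ℝ≥0∞) (hS : ∀ i, ∑' j, u i j ≤ S)
    (x : ι → ℝ≥0∞) : ∑' i, ∑' j, u i j * (x i * x j) ≤ 2 * S * ∑' i, x i ^ 2 := by
  have h1 : ∑' i, ∑' j, u i j * x i ^ 2 ≤ S * ∑' i, x i ^ 2 := by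
    rw [← ENNReal.tsum_mul_left]
    refine ENNReal.tsum_le_tsum fun i => ?_
    rw [ENNReal.tsum_mul_right]
    exact mul_le_mul' (hS i) le_rfl
  have h2 : ∑' i, ∑' j, u i j * x j ^ 2 ≤ S * ∑' i, x i ^ 2 := by
    rw [ENNReal.tsum_comm]
    simpa only [hsym] using h1
  calc _ ≤ ∑' i, ∑' j, (u i j * x i ^ 2 + u i j * x j ^ 2) := by
        refine ENNReal.tsum_le_tsum fun i => ENNReal.tsum_le_tsum fun j => ?_
        rw [← mul_add]
        exact mul_le_mul' le_rfl (enn_two_mul_le _ _)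
    _ = ∑' i, ∑' j, u i j * x i ^ 2 + ∑' i, ∑' j, u i j * x j ^ 2 := by
        simp_rw [ENNReal.tsum_add]
    _ ≤ S * ∑' i, x i ^ 2 + S * ∑' i, x i ^ 2 := add_le_add h1 h2
    _ = _ := by ring

lemma schur_sq {ι : Type*} (v : ι → ℝ≥0∞) (S : ℝ≥0∞) (hS : ∑' j, v j ≤ S)
    (x : ι → ℝ≥0∞) : (∑' j, v j * x j) ^ 2 ≤ 2 * S * ∑' j, v j * x j ^ 2 := by
  have h1 : ∑' i, ∑' j, v i * v j * x i ^ 2 ≤ S * ∑' i, v i * x i ^ 2 := by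
    rw [← ENNReal.tsum_mul_left]
    refine ENNReal.tsum_le_tsum fun i => ?_
    have : ∀ j, v i * v j * x i ^ 2 = v j * (v i * x i ^ 2) := fun j => by ring
    simp_rw [this]
    rw [ENNReal.tsum_mul_right]
    exact mul_le_mul' hS le_rfl
  have h2 : ∑' i, ∑' j, v i * v j * x j ^ 2 ≤ S * ∑' i, v i * x i ^ 2 := by
    rw [ENNReal.tsum_comm]
    have : ∀ i j, v i * v j = v j * v i := fun i j => mul_comm _ _
    refine le_trans (le_of_eq ?_) h1
    congr 1; ext i; congr 1; ext j; ring
  calc (∑' j, v j * x j) ^ 2 = ∑' i, ∑' j, (v i * x i) * (v j * x j) := by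
        rw [sq, ← ENNReal.tsum_mul_right]
        congr 1; ext i
        rw [ENNReal.tsum_mul_left]
    _ ≤ ∑' i, ∑' j, (v i * v j * x i ^ 2 + v i * v j * x j ^ 2) := by
        refine ENNReal.tsum_le_tsum fun i => ENNReal.tsum_le_tsum fun j => ?_
        rw [← mul_add, mul_mul_mul_comm]
        exact mul_le_mul' le_rfl (enn_two_mul_le _ _)
    _ = ∑' i, ∑' j, v i * v j * x i ^ 2 + ∑' i, ∑' j, v i * v j * x j ^ 2 := by
        simp_rw [ENNReal.tsum_add]
    _ ≤ _ := add_le_add h1 h2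
    _ = _ := by ring

lemma path_sum {ι : Type*} (u : ι → ι → ℝ≥0∞) (hsym : ∀ i j, u i j = u j i) (S : ℝ≥0∞) (hS : ∀ i, ∑' j, u i j ≤ S)
    (E : ι → ℝ≥0∞) : ∑' i, ∑' j, ∑' k, ∑' l, (u i j * u i k * u j l) * (E i * E j * E k * E l) ≤
      8 * S ^ 3 * ∑' i, E i ^ 4 := by
  set G : ι → ℝ≥0∞ := fun i => E i * ∑' k, u i k * E k with hG
  have e : ∀ i j, ∑' k, ∑' l, (u i j * u i k * u j l) * (E i * E j * E k * E l) = u i j * (G i * G j) := by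
    intro i j
    have : ∀ k l, (u i j * u i k * u j l) * (E i * E j * E k * E l) =
      (u i j * (E i * E j) * (u i k * E k)) * (u j l * E l) := fun k l => by ring
    simp_rw [this, ENNReal.tsum_mul_left, ENNReal.tsum_mul_right, ENNReal.tsum_mul_left, hG]
    ring
  simp_rw [e]
  refine (schurE u hsym S hS G).trans ?_
  have h1 : ∑' i, G i ^ 2 ≤ 2 * S * (2 * S * ∑' i, E i ^ 4) := by
    calc ∑' i, G i ^ 2 ≤ ∑' i, 2 * S * ∑' j, u i j * (E i ^ 2 * E j ^ 2) := by
          refine ENNReal.tsum_le_tsum fun i => ?_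
          rw [hG, mul_pow]
          refine (mul_le_mul' le_rfl (schur_sq (u i) S (hS i) E)).trans (le_of_eq ?_)
          rw [mul_left_comm, ← ENNReal.tsum_mul_left]
          congr 1
          congr 1; ext j; ring
      _ = 2 * S * ∑' i, ∑' j, u i j * (E i ^ 2 * E j ^ 2) := ENNReal.tsum_mul_left
      _ ≤ _ := by
        refine mul_le_mul' le_rfl ((schurE u hsym S hS (fun i => E i ^ 2)).trans (le_of_eq ?_))
        congr 1; congr 1; ext i; ring
  refine (mul_le_mul' le_rfl h1).trans (le_of_eq ?_)
  ring

lemma cs_sq {X : Type*} [MeasurableSpace X] (μ : Measure X) (f g : X → ℝ≥0∞) (hf : Measurable f) (hg : Measurable g) :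
    (∫⁻ x, f x * g x ∂μ) ^ 2 ≤ (∫⁻ x, f x ^ 2 ∂μ) * ∫⁻ x, g x ^ 2 ∂μ := by
  have h := ENNReal.lintegral_mul_le_Lp_mul_Lq μ (p := 2) (q := 2) (by constructor <;> norm_num) hf.aemeasurable hg.aemeasurable
  have h2 := pow_le_pow_left' h 2
  refine h2.trans (le_of_eq ?_)
  rw [mul_pow, ← ENNReal.rpow_natCast, ← ENNReal.rpow_natCast, ← ENNReal.rpow_mul, ← ENNReal.rpow_mul]
  norm_num

lemma quad {X ι : Type*} [Countable ι] [MeasurableSpace X] (μ : Measure X) (b : ι → X → ℝ≥0∞) (hb : ∀ i, Measurable (b i))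
    (u : ι → ι → ℝ≥0∞) (hsym : ∀ i j, u i j = u j i) (hu : ∀ i j, u i j ≤ 1) (S : ℝ≥0∞) (hS : ∀ i, ∑' j, u i j ≤ S)
    (E : ι → ℝ≥0∞) (B : ℝ≥0∞)
    (h : ∀ i j, ∫⁻ x, b i x ^ 2 * b j x ^ 2 ∂μ ≤ B * (u i j) ^ 4 * E i ^ 2 * E j ^ 2) :
    ∫⁻ x, (∑' i, b i x) ^ 4 ∂μ ≤ B * (8 * S ^ 3 * ∑' i, E i ^ 4) := by
  have e : ∀ x, (∑' i, b i x) ^ 4 = ∑' i, ∑' j, ∑' k, ∑' l, (b i x * b j x) * (b k x * b l x) := by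
    intro x
    simp_rw [ENNReal.tsum_mul_left, ENNReal.tsum_mul_right, ENNReal.tsum_mul_left, ENNReal.tsum_mul_right]
    ring
  simp_rw [e]
  have m4 : ∀ i j k l, Measurable (fun x => (b i x * b j x) * (b k x * b l x)) := fun i j k l =>
    ((hb i).mul (hb j)).mul ((hb k).mul (hb l))
  have m3 : ∀ i j k, Measurable (fun x => ∑' l, (b i x * b j x) * (b k x * b l x)) := fun i j k => Measurable.tsum (m4 i j k)
  have m2 : ∀ i j, Measurable (fun x => ∑' k, ∑' l, (b i x * b j x) * (b k x * b l x)) := fun i j => Measurable.tsum (m3 i j)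
  have m1 : ∀ i, Measurable (fun x => ∑' j, ∑' k, ∑' l, (b i x * b j x) * (b k x * b l x)) := fun i => Measurable.tsum (m2 i)
  rw [lintegral_tsum (fun i => (m1 i).aemeasurable)]
  simp_rw [fun i => lintegral_tsum (μ := μ) (fun j => (m2 i j).aemeasurable), fun i j => lintegral_tsum (μ := μ) (fun k => (m3 i j k).aemeasurable),
    fun i j k => lintegral_tsum (μ := μ) (fun l => (m4 i j k l).aemeasurable)]
  have key : ∀ i j k l, ∫⁻ x, (b i x * b j x) * (b k x * b l x) ∂μ ≤ B * ((u i j * u i k * u j l) * (E i * E j * E k * E l)) := by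
    intro i j k l
    set Y := ∫⁻ x, (b i x * b j x) * (b k x * b l x) ∂μ with hY
    set Q := E i * E j * E k * E l with hQ
    have b1 : Y ^ 2 ≤ (B * u i j ^ 2 * Q) ^ 2 := by
      refine (cs_sq μ _ _ ((hb i).mul (hb j)) ((hb k).mul (hb l))).trans ?_
      simp_rw [Pi.mul_apply, mul_pow]
      refine (mul_le_mul' (h i j) (h k l)).trans ?_
      calc _ ≤ B * u i j ^ 4 * E i ^ 2 * E j ^ 2 * (B * 1 ^ 4 * E k ^ 2 * E l ^ 2) := by
            gcongr
            exact hu k l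
        _ = _ := by rw [hQ]; ring
    have b2 : Y ^ 2 ≤ (B * (u i k ^ 2 * u j l ^ 2) * Q) ^ 2 := by
      have hY' : Y = ∫⁻ x, (b i x * b k x) * (b j x * b l x) ∂μ := by
        rw [hY]; congr 1; ext x; ring
      rw [hY']
      refine (cs_sq μ _ _ ((hb i).mul (hb k)) ((hb j).mul (hb l))).trans ?_
      simp_rw [Pi.mul_apply, mul_pow]
      refine (mul_le_mul' (h i k) (h j l)).trans (le_of_eq ?_)
      rw [hQ]; ring
    have c1 : Y ≤ B * u i j ^ 2 * Q := (ENNReal.pow_le_pow_left_iff (by norm_num)).1 b1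
    have c2 : Y ≤ B * (u i k ^ 2 * u j l ^ 2) * Q := (ENNReal.pow_le_pow_left_iff (by norm_num)).1 b2
    refine (ENNReal.pow_le_pow_left_iff (n := 2) (by norm_num)).1 ?_
    rw [sq Y]
    refine (mul_le_mul' c1 c2).trans (le_of_eq ?_)
    ring
  calc _ ≤ ∑' i, ∑' j, ∑' k, ∑' l, B * ((u i j * u i k * u j l) * (E i * E j * E k * E l)) :=
        ENNReal.tsum_le_tsum fun i => ENNReal.tsum_le_tsum fun j => ENNReal.tsum_le_tsum fun k => ENNReal.tsum_le_tsum fun l => key i j k l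
    _ = B * ∑' i, ∑' j, ∑' k, ∑' l, (u i j * u i k * u j l) * (E i * E j * E k * E l) := by
        simp_rw [ENNReal.tsum_mul_left]
    _ ≤ _ := mul_le_mul' le_rfl (path_sum u hsym S hS E)

lemma tsum_rpow_le {ι : Type*} (x : ι → ℝ≥0∞) {p : ℝ} (hp : 0 < p) (hp1 : p ≤ 1) : (∑' i, x i) ^ p ≤ ∑' i, x i ^ p := by
  have : Filter.Tendsto (fun T : Finset ι => (∑ i ∈ T, x i) ^ p) Filter.atTop (nhds ((∑' i, x i) ^ p)) :=
    (ENNReal.continuous_rpow_const.tendsto _).comp ENNReal.summable.hasSum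
  exact le_of_tendsto' this fun T => (ennreal_rpow_sum_le T x hp hp1).trans (ENNReal.sum_le_tsum T)

lemma tsum_rpow_ge {ι : Type*} (x : ι → ℝ≥0∞) {p : ℝ} (hp : 1 ≤ p) : ∑' i, x i ^ p ≤ (∑' i, x i) ^ p := by
  have e : ∀ y : ℝ≥0∞, y ^ p = y ^ (p - 1) * y := by
    intro y
    conv_rhs => rw [← ENNReal.rpow_one y, ← ENNReal.rpow_mul, one_mul]
    rw [← ENNReal.rpow_add_of_nonneg _ _ (by linarith) (by norm_num)]
    congr 1; ring
  calc ∑' i, x i ^ p ≤ ∑' i, (∑' j, x j) ^ (p - 1) * x i := by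
        refine ENNReal.tsum_le_tsum fun i => ?_
        rw [e]
        exact mul_le_mul' (ENNReal.rpow_le_rpow (ENNReal.le_tsum i) (by linarith)) le_rfl
    _ = _ := by rw [ENNReal.tsum_mul_left, ← e]


lemma interpE {X P a b : ℝ≥0∞} {θ : ℝ} (h0 : 0 ≤ θ) (h1 : θ ≤ 1) (ha : X ≤ a * P) (hb : X ≤ b * P) :
    X ≤ a ^ (1 - θ) * b ^ θ * P := by
  have e : ∀ y : ℝ≥0∞, y = y ^ (1 - θ) * y ^ θ := by
    intro y
    rw [← ENNReal.rpow_add_of_nonneg _ _ (by linarith) h0]; simp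
  calc X = X ^ (1 - θ) * X ^ θ := e X
    _ ≤ (a * P) ^ (1 - θ) * (b * P) ^ θ :=
      mul_le_mul' (ENNReal.rpow_le_rpow ha (by linarith)) (ENNReal.rpow_le_rpow hb h0)
    _ = a ^ (1 - θ) * b ^ θ * (P ^ (1 - θ) * P ^ θ) := by
      rw [ENNReal.mul_rpow_of_nonneg _ _ (by linarith), ENNReal.mul_rpow_of_nonneg _ _ h0]; ring
    _ = _ := by rw [← e P]

lemma cs_eLp {s : ℝ} (hs : 0 < s) (F G : ℝ × ℝ × ℝ → ℂ) (hF : Continuous F) (hG : Continuous G) :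
    eLpNorm (fun p => F p * G p) (ENNReal.ofReal s) volume ≤
      eLpNorm F (ENNReal.ofReal (2 * s)) volume * eLpNorm G (ENNReal.ofReal (2 * s)) volume := by
  have h2s : 0 < 2 * s := by linarith
  rw [← ENNReal.rpow_le_rpow_iff h2s, ENNReal.mul_rpow_of_nonneg _ _ h2s.le,
    ← lintegral_eq_eLpNorm h2s, ← lintegral_eq_eLpNorm h2s, mul_comm 2 s, ENNReal.rpow_mul,
    ← lintegral_eq_eLpNorm hs]
  have := cs_sq volume (fun p => ‖F p‖ₑ ^ s) (fun p => ‖G p‖ₑ ^ s) (hF.enorm.measurable.pow_const s) (hG.enorm.measurable.pow_const s)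
  rw [show ((2 : ℝ)) = ((2 : ℕ) : ℝ) by norm_num]
  simp_rw [ENNReal.rpow_mul, ENNReal.rpow_natCast, enorm_mul]
  simp_rw [fun x : ℝ × ℝ × ℝ => ENNReal.mul_rpow_of_nonneg ‖F x‖ₑ ‖G x‖ₑ hs.le]
  exact this

lemma pair_bound {s r A c C₁ C₂ : ℝ} (hs : 1 < s) (hs2 : s ≤ 2) (hr : 0 < r) (hA : 0 ≤ A) (h : BH s r A)
    (hc : 0 < c) (h1 : c ≤ 1 - 1 / s)
    (h2 : 2 * c ≤ 3 * (1 - 1 / s) - 1) (h3 : c ≤ 1 / r - (1 - 1 / s)) (hC₁ : 0 < C₁) (hC₂ : 0 < C₂) :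
    ∃ (C₄ : ℝ≥0∞) (κ : ℝ), C₄ ≠ ⊤ ∧ 0 < κ ∧ ∀ (δ : ℝ), 0 < δ → ∀ (J K J' K' : ℕ) (T T' : Finset (ℤ × ℤ))
      (U U' : Set (ℝ × ℝ)) (D D' : ℝ≥0∞), MeasurableSet U → MeasurableSet U' → volume U ≠ ⊤ → volume U' ≠ ⊤ →
      U ⊆ (⋃ p ∈ T, tile (J : ℤ) (K : ℤ) p.1 p.2) → U' ⊆ (⋃ p ∈ T', tile (J' : ℤ) (K' : ℤ) p.1 p.2) →
      (T.card : ℝ) ≤ C₁ * δ ^ (-C₂) → (T'.card : ℝ) ≤ C₁ * δ ^ (-C₂) →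
      ENNReal.ofReal ((2 : ℝ) ^ (-(1 - 1 / s) * ((J : ℝ) + K))) ≤ ENNReal.ofReal ((4 : ℝ) ^ (1 - 1 / s)) * D →
      ENNReal.ofReal ((2 : ℝ) ^ (-(1 - 1 / s) * ((J' : ℝ) + K'))) ≤ ENNReal.ofReal ((4 : ℝ) ^ (1 - 1 / s)) * D' →
      eLpNorm (extOp (chi U)) (ENNReal.ofReal (2 * s)) volume ≤ ENNReal.ofReal (C₁ * δ) * D →
      eLpNorm (extOp (chi U')) (ENNReal.ofReal (2 * s)) volume ≤ ENNReal.ofReal (C₁ * δ) * D' →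
      eLpNorm (fun p => extOp (chi U) p * extOp (chi U') p) (ENNReal.ofReal s) volume ≤
        C₄ * ENNReal.ofReal (δ ^ (1 / s)) * ENNReal.ofReal ((2 : ℝ) ^ (-(κ * |(K : ℝ) - K'|))) * (D * D') := by
  set θ : ℝ := (2 - 1 / s) / (2 + 2 * C₂) with hθ
  have hs0 : 0 < 1 / s := by positivity
  have hs1 : 1 / s < 1 := by rw [div_lt_one (by linarith)]; exact hs
  have hθ0 : 0 < θ := div_pos (by linarith) (by linarith)
  have hθ1 : θ ≤ 1 := by rw [hθ, div_le_one (by linarith)]; linarith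
  have hθe : 2 * (1 - θ) + -(2 * C₂) * θ = 1 / s := by
    have : θ * (2 + 2 * C₂) = 2 - 1 / s := div_mul_cancel₀ _ (by linarith)
    linarith
  set Cb : ℝ≥0∞ := ENNReal.ofReal (C₁ ^ 2) * (ENNReal.ofReal (9216 * (Wc * A)) * Sg (c / 2) ^ 2) * ENNReal.ofReal ((4 : ℝ) ^ (1 - 1 / s)) ^ 2 with hCb
  have hSg := Sg_ne_top (c := c / 2) (by linarith)
  have hCbt : Cb ≠ ⊤ := by
    rw [hCb]
    refine ENNReal.mul_ne_top (ENNReal.mul_ne_top ENNReal.ofReal_ne_top (ENNReal.mul_ne_top ENNReal.ofReal_ne_top (ENNReal.pow_ne_top hSg))) (ENNReal.pow_ne_top ENNReal.ofReal_ne_top)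
  refine ⟨ENNReal.ofReal (C₁ ^ 2) ^ (1 - θ) * Cb ^ θ, c / 2 * θ,
    ENNReal.mul_ne_top (ENNReal.rpow_ne_top_of_nonneg (by linarith) ENNReal.ofReal_ne_top) (ENNReal.rpow_ne_top_of_nonneg hθ0.le hCbt), by positivity, ?_⟩
  intro δ hδ J K J' K' T T' U U' D D' hU hU' vU vU' hT hT' cT cT' hD hD' hF hF'
  have b1 : eLpNorm (fun p => extOp (chi U) p * extOp (chi U') p) (ENNReal.ofReal s) volume ≤
      (ENNReal.ofReal (C₁ ^ 2) * ENNReal.ofReal (δ ^ 2)) * (D * D') := by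
    refine (cs_eLp (by linarith) _ _ (continuous_extOp (integrable_chi hU vU)) (continuous_extOp (integrable_chi hU' vU'))).trans ?_
    refine (mul_le_mul' hF hF').trans (le_of_eq ?_)
    rw [ENNReal.ofReal_mul hC₁.le, ENNReal.ofReal_pow hC₁.le, ENNReal.ofReal_pow hδ.le]; ring
  have cT2 : (T.card : ℝ≥0∞) ≤ ENNReal.ofReal (C₁ * δ ^ (-C₂)) := by
    rw [← ENNReal.ofReal_natCast]; exact ENNReal.ofReal_le_ofReal cT
  have cT2' : (T'.card : ℝ≥0∞) ≤ ENNReal.ofReal (C₁ * δ ^ (-C₂)) := by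
    rw [← ENNReal.ofReal_natCast]; exact ENNReal.ofReal_le_ofReal cT'
  set w : ℝ := (2 : ℝ) ^ (-(c / 2 * |(K : ℝ) - K'|)) with hw
  have b2 : eLpNorm (fun p => extOp (chi U) p * extOp (chi U') p) (ENNReal.ofReal s) volume ≤
      (Cb * ENNReal.ofReal (δ ^ (-(2 * C₂))) * ENNReal.ofReal w) * (D * D') := by
    refine (tiles_pair hs hs2 hr hA h hc.le h1 h2 h3 J K J' K' T T' U U' hU hU' vU vU' hT hT').trans ?_
    simp only [Int.cast_natCast]
    rw [← hw, ENNReal.ofReal_mul (q := w) (by positivity), ENNReal.ofReal_mul (p := (2 : ℝ) ^ (-(1 - 1 / s) * ((J : ℝ) + K))) (by positivity)]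
    refine (mul_le_mul' cT2 (mul_le_mul' cT2' (mul_le_mul' le_rfl (mul_le_mul' (mul_le_mul' hD hD') le_rfl)))).trans (le_of_eq ?_)
    have : δ ^ (-(2 * C₂)) = δ ^ (-C₂) * δ ^ (-C₂) := by
      rw [← Real.rpow_add hδ]; congr 1; ring
    rw [this, hCb, ENNReal.ofReal_mul (p := C₁) (by positivity), ENNReal.ofReal_mul (p := δ ^ (-C₂)) (by positivity), ENNReal.ofReal_pow hC₁.le]
    ring
  refine (interpE hθ0.le hθ1 b1 b2).trans (le_of_eq ?_)
  congr 1
  have hw0 : 0 < w := by positivity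
  have e1 : ENNReal.ofReal (δ ^ (1 / s)) = ENNReal.ofReal (δ ^ 2) ^ (1 - θ) * ENNReal.ofReal (δ ^ (-(2 * C₂))) ^ θ := by
    rw [ENNReal.ofReal_rpow_of_pos (by positivity), ENNReal.ofReal_rpow_of_pos (by positivity), ← ENNReal.ofReal_mul (by positivity),
      ← Real.rpow_natCast, ← Real.rpow_mul hδ.le, ← Real.rpow_mul hδ.le, ← Real.rpow_add hδ, ← hθe]
    norm_num
  have e2 : ENNReal.ofReal ((2 : ℝ) ^ (-(c / 2 * θ * |(K : ℝ) - K'|))) = ENNReal.ofReal w ^ θ := by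
    rw [ENNReal.ofReal_rpow_of_pos hw0, hw, ← Real.rpow_mul (by norm_num)]
    congr 2; ring
  rw [e1, e2, ENNReal.mul_rpow_of_nonneg _ _ (by linarith), ENNReal.mul_rpow_of_nonneg _ _ hθ0.le, ENNReal.mul_rpow_of_nonneg _ _ hθ0.le]
  ring

lemma final_sum {s : ℝ} (hs : 1 < s) (hs2 : s ≤ 2) {κ : ℝ} (hκ : 0 < κ) (Ks : Set ℕ) (F : ℕ → ℝ × ℝ × ℝ → ℂ)
    (hF : ∀ K ∈ Ks, Continuous (F K)) (D : ℕ → ℝ≥0∞) (C : ℝ≥0∞)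
    (h : ∀ K ∈ Ks, ∀ K' ∈ Ks, eLpNorm (fun p => F K p * F K' p) (ENNReal.ofReal s) volume ≤
      C * ENNReal.ofReal ((2 : ℝ) ^ (-(κ * |(K : ℝ) - K'|))) * (D K * D K')) :
    eLpNorm (fun p => ∑' K : ↥Ks, F K p) (ENNReal.ofReal (2 * s)) volume ^ (2 * s) ≤
      C ^ s * (8 * Sg (κ * s / 4) ^ 3 * ∑' K : ↥Ks, D K ^ (2 * s)) := by
  have h2s : 0 < 2 * s := by linarith
  have hs0 : 0 < s := by linarith
  rw [← lintegral_eq_eLpNorm h2s]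
  set b : ↥Ks → ℝ × ℝ × ℝ → ℝ≥0∞ := fun K p => ‖F K p‖ₑ ^ (s / 2) with hb
  have hbm : ∀ K, Measurable (b K) := fun K => (hF K K.2).enorm.measurable.pow_const _
  have hpt : ∀ p, ‖∑' K : ↥Ks, F K p‖ₑ ^ (2 * s) ≤ (∑' K, b K p) ^ 4 := by
    intro p
    calc ‖∑' K : ↥Ks, F K p‖ₑ ^ (2 * s) ≤ (∑' K : ↥Ks, ‖F K p‖ₑ) ^ (2 * s) :=
          ENNReal.rpow_le_rpow enorm_tsum_le_tsum_enorm h2s.le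
      _ = ((∑' K : ↥Ks, ‖F K p‖ₑ) ^ (s / 2)) ^ 4 := by
          rw [← ENNReal.rpow_natCast, ← ENNReal.rpow_mul]; congr 1; push_cast; ring
      _ ≤ _ := pow_le_pow_left' (tsum_rpow_le _ (by linarith) (by linarith)) 4
  refine (lintegral_mono hpt).trans ?_
  set u : ↥Ks → ↥Ks → ℝ≥0∞ := fun K K' => ENNReal.ofReal ((2 : ℝ) ^ (-(κ * s / 4 * |((K : ℕ) : ℝ) - (K' : ℕ)|))) with hu
  have hq := quad volume b hbm u (fun i j => by simp only [hu]; rw [abs_sub_comm]) (fun i j => by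
      simp only [hu]
      rw [ENNReal.ofReal_le_one]
      refine Real.rpow_le_one_of_one_le_of_nonpos (by norm_num) ?_
      have : 0 ≤ κ * s / 4 * |((i : ℕ) : ℝ) - (j : ℕ)| := by positivity
      linarith) (Sg (κ * s / 4)) (fun i => by
      rw [← Sg_shift (κ * s / 4) ((i : ℕ) : ℤ)]
      have := ENNReal.tsum_comp_le_tsum_of_injective (f := fun j : ↥Ks => (((j : ℕ)) : ℤ))
        (fun a b hab => Subtype.ext (Int.ofNat_inj.1 hab))
        (fun n : ℤ => ENNReal.ofReal ((2 : ℝ) ^ (-(κ * s / 4 * |(n : ℝ) - (((i : ℕ) : ℤ) : ℝ)|))))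
      refine le_trans (le_of_eq ?_) this
      congr 1; ext j
      simp only [hu]
      rw [abs_sub_comm]
      simp) (fun K => D K ^ (s / 2)) (C ^ s) (fun i j => by
      have e : ∀ p, b i p ^ 2 * b j p ^ 2 = ‖F i p * F j p‖ₑ ^ s := by
        intro p
        simp only [hb]
        rw [← mul_pow, ← ENNReal.mul_rpow_of_nonneg _ _ (by linarith), ← enorm_mul, ← ENNReal.rpow_natCast, ← ENNReal.rpow_mul]
        congr 1; push_cast; ring
      simp_rw [e]
      rw [lintegral_eq_eLpNorm hs0]
      refine (ENNReal.rpow_le_rpow (h i i.2 j j.2) hs0.le).trans (le_of_eq ?_)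
      rw [ENNReal.mul_rpow_of_nonneg _ _ hs0.le, ENNReal.mul_rpow_of_nonneg _ _ hs0.le, ENNReal.mul_rpow_of_nonneg _ _ hs0.le]
      have e1 : u i j ^ 4 = ENNReal.ofReal ((2 : ℝ) ^ (-(κ * |((i : ℕ) : ℝ) - (j : ℕ)|))) ^ s := by
        simp only [hu]
        rw [← ENNReal.rpow_natCast, ENNReal.ofReal_rpow_of_pos (by positivity), ENNReal.ofReal_rpow_of_pos (by positivity),
          ← Real.rpow_mul (by norm_num), ← Real.rpow_mul (by norm_num)]
        congr 2; push_cast; ring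
      have e2 : ∀ y : ℝ≥0∞, (y ^ (s / 2)) ^ 2 = y ^ s := by
        intro y
        rw [← ENNReal.rpow_natCast, ← ENNReal.rpow_mul]; congr 1; push_cast; ring
      rw [e1, e2, e2]; ring)
  refine hq.trans (le_of_eq ?_)
  congr 3; ext K
  rw [← ENNReal.rpow_natCast, ← ENNReal.rpow_mul]; congr 1; push_cast; ring


/-- decoupling across fiber-length scales: under BH(s,r) with `3/2 < s < 2`,
`r < s'`, and given constants `C₁, C₂ > 0` quantifying the near-tile decomposition, there is
`C₃ > 0` such that the following holds.  Let `Ω ⊆ [0,1]²` be measurable, let `ε, δ` be dyadic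
with `0 < δ ≤ ε`, let `J(K)` satisfy `|π₁(Ω(K))| ∼ 2^{-J(K)}`, and for each `K ∈ 𝓚(ε)` let
`Ω_δ(K) ⊆ Ω(K)` be a piece of the near-tile decomposition: measurable, contained in a union
of at most `C₁ δ^{-C₂}` tiles of `𝓓_{J(K),K}`, and with `∥𝓔χ_{Ω'}∥_{2s} ≤ C₁ δ |Ω(K)|^{1/s'}`
for all measurable `Ω' ⊆ Ω_δ(K)`.  Then
`∥Σ_{K ∈ 𝓚(ε)} 𝓔χ_{Ω_δ(K)}∥_{2s}^{2s} ≤ C₃ (log δ⁻¹)² Σ_{K ∈ 𝓚(ε)} ∥𝓔χ_{Ω_δ(K)}∥_{2s}^{2s} + C₃ δ |Ω|^{2s/s'}`. -/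
theorem stmt10 (s r A C₁ C₂ : ℝ) (hs₁ : 3 / 2 < s) (hs₂ : s < 2) (hr : r < s / (s - 1))
    (hBH : BH s r A) (hC₁ : 0 < C₁) (hC₂ : 0 < C₂) :
    ∃ C₃ : ℝ, 0 < C₃ ∧
      ∀ (Ω : Set (ℝ × ℝ)), MeasurableSet Ω → Ω ⊆ Icc 0 1 ×ˢ Icc 0 1 →
      ∀ (ε δ : ℝ), IsDyadic ε → IsDyadic δ → 0 < δ → δ ≤ ε →
      ∀ (J : ℕ → ℕ) (Ωδ : ℕ → Set (ℝ × ℝ)),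
        (∀ K ∈ KsetOf s Ω ε,
          (2 : ℝ≥0∞) ^ (-(J K : ℤ) - 1) ≤ volume (Prod.fst '' fiberPiece Ω K) ∧
            volume (Prod.fst '' fiberPiece Ω K) ≤ (2 : ℝ≥0∞) ^ (-(J K : ℤ) + 1)) →
        (∀ K ∈ KsetOf s Ω ε, MeasurableSet (Ωδ K) ∧ Ωδ K ⊆ fiberPiece Ω K ∧
          (∃ T : Finset (ℤ × ℤ), (T.card : ℝ) ≤ C₁ * δ ^ (-C₂) ∧
            Ωδ K ⊆ ⋃ p ∈ T, tile (J K : ℤ) (K : ℤ) p.1 p.2) ∧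
          ∀ Ω' ⊆ Ωδ K, MeasurableSet Ω' →
            eLpNorm (extOp (chi Ω')) (ENNReal.ofReal (2 * s)) volume ≤
              ENNReal.ofReal (C₁ * δ) * volume (fiberPiece Ω K) ^ (1 - 1 / s)) →
        eLpNorm (fun p => ∑' K : ↥(KsetOf s Ω ε), extOp (chi (Ωδ ↑K)) p)
            (ENNReal.ofReal (2 * s)) volume ^ (2 * s) ≤
          ENNReal.ofReal (C₃ * Real.log δ⁻¹ ^ 2) *
              ∑' K : ↥(KsetOf s Ω ε),
                eLpNorm (extOp (chi (Ωδ ↑K))) (ENNReal.ofReal (2 * s)) volume ^ (2 * s) +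
            ENNReal.ofReal (C₃ * δ) * volume Ω ^ (2 * s * (1 - 1 / s)) := by
  have hs1 : 1 < s := by linarith
  have hs0 : 0 < s := by linarith
  obtain ⟨r', hr', hrs, hB⟩ := BH_pos hr hs1 hBH
  have hq1 : 1 / s < 2 / 3 := by rw [div_lt_iff₀ hs0]; linarith
  have hq2 : 0 < 1 / s := by positivity
  have hr2 : 1 - 1 / s < 1 / r' := by
    have e : 1 - 1 / s = 1 / (s / (s - 1)) := by field_simp
    rw [e]
    exact one_div_lt_one_div_of_lt hr' hrs
  obtain ⟨c, hc0, hc1, hc2, hc3⟩ : ∃ c : ℝ, 0 < c ∧ c ≤ 1 - 1 / s ∧ 2 * c ≤ 3 * (1 - 1 / s) - 1 ∧ c ≤ 1 / r' - (1 - 1 / s) := by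
    refine ⟨min (1 - 1 / s) (min ((3 * (1 - 1 / s) - 1) / 2) (1 / r' - (1 - 1 / s))), ?_, min_le_left _ _, ?_, ?_⟩
    · exact lt_min (by linarith) (lt_min (by linarith) (by linarith))
    · have := (min_le_right (1 - 1 / s) (min ((3 * (1 - 1 / s) - 1) / 2) (1 / r' - (1 - 1 / s)))).trans (min_le_left _ _)
      linarith
    · exact (min_le_right _ _).trans (min_le_right _ _)
  obtain ⟨C₄, κ, hC₄, hκ, hpair⟩ := pair_bound hs1 hs₂.le hr' (abs_nonneg A) hB hc0 hc1 hc2 hc3 hC₁ hC₂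
  have hqe : 0 ≤ 2 * s * (1 - 1 / s) := mul_nonneg (by linarith) (by linarith)
  set Z : ℝ≥0∞ := C₄ ^ s * (8 * Sg (κ * s / 4) ^ 3) * 3 ^ (2 * s * (1 - 1 / s)) with hZ
  have hZt : Z ≠ ⊤ := by
    have hSg := Sg_ne_top (c := κ * s / 4) (by positivity)
    exact ENNReal.mul_ne_top (ENNReal.mul_ne_top (ENNReal.rpow_ne_top_of_nonneg hs0.le hC₄)
      (ENNReal.mul_ne_top (by norm_num) (ENNReal.pow_ne_top hSg))) (ENNReal.rpow_ne_top_of_nonneg hqe (by norm_num))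
  refine ⟨Z.toReal + 1, by positivity, ?_⟩
  intro Ω hΩ hΩs ε δ _ _ hδ _ J Ωδ hJ hδK
  refine le_trans ?_ le_add_self
  have hvΩ : volume Ω ≠ ⊤ := measure_ne_top_of_subset hΩs (isCompact_Icc.prod isCompact_Icc).measure_ne_top
  have hvδ : ∀ K ∈ KsetOf s Ω ε, volume (Ωδ K) ≠ ⊤ := fun K hK =>
    measure_ne_top_of_subset ((hδK K hK).2.1.trans (fun ξ hx => hx.1)) hvΩ
  have hfin := final_sum hs1 hs₂.le hκ (KsetOf s Ω ε) (fun K => extOp (chi (Ωδ K)))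
    (fun K hK => continuous_extOp (integrable_chi (hδK K hK).1 (hvδ K hK)))
    (fun K => volume (fiberPiece Ω K) ^ (1 - 1 / s)) (C₄ * ENNReal.ofReal (δ ^ (1 / s))) (by
      intro K hK K' hK'
      obtain ⟨m1, s1, ⟨T, cT, hT⟩, v1⟩ := hδK K hK
      obtain ⟨m2, s2, ⟨T', cT', hT'⟩, v2⟩ := hδK K' hK'
      exact hpair δ hδ (J K) K (J K') K' T T' (Ωδ K) (Ωδ K') _ _ m1 m2 (hvδ K hK) (hvδ K' hK') hT hT' cT cT'
        (vol_lower hΩ K (J K) (hJ K hK).1 (by linarith)) (vol_lower hΩ K' (J K') (hJ K' hK').1 (by linarith))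
        (v1 _ subset_rfl m1) (v2 _ subset_rfl m2))
  refine hfin.trans ?_
  have hsum : ∑' K : ↥(KsetOf s Ω ε), (volume (fiberPiece Ω K) ^ (1 - 1 / s)) ^ (2 * s) ≤
      3 ^ (2 * s * (1 - 1 / s)) * volume Ω ^ (2 * s * (1 - 1 / s)) := by
    have e : ∀ y : ℝ≥0∞, (y ^ (1 - 1 / s)) ^ (2 * s) = y ^ (2 * s * (1 - 1 / s)) := by
      intro y
      rw [← ENNReal.rpow_mul, mul_comm]
    simp_rw [e]
    rw [← ENNReal.mul_rpow_of_nonneg _ _ hqe]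
    refine (tsum_rpow_ge _ ?_).trans (ENNReal.rpow_le_rpow ?_ hqe)
    · have : 2 * s * (1 - 1 / s) = 2 * s - 2 := by field_simp
      linarith
    · exact (ENNReal.tsum_comp_le_tsum_of_injective Subtype.val_injective (fun K => volume (fiberPiece Ω K))).trans (sum_vol hΩ)
  refine (mul_le_mul' le_rfl (mul_le_mul' le_rfl hsum)).trans ?_
  have eδ : ENNReal.ofReal (δ ^ (1 / s)) ^ s = ENNReal.ofReal δ := by
    rw [ENNReal.ofReal_rpow_of_pos (by positivity), ← Real.rpow_mul hδ.le, one_div_mul_cancel hs0.ne', Real.rpow_one]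
  rw [ENNReal.mul_rpow_of_nonneg _ _ hs0.le, eδ]
  calc _ = Z * ENNReal.ofReal δ * volume Ω ^ (2 * s * (1 - 1 / s)) := by rw [hZ]; ring
    _ ≤ _ := by
      refine mul_le_mul' ?_ le_rfl
      rw [ENNReal.ofReal_mul (by positivity)]
      refine mul_le_mul' ?_ le_rfl
      rw [ENNReal.le_ofReal_iff_toReal_le hZt (by positivity)]
      linarith
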